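/- arXiv:1710.06045 — 2 statements merged into one kernel-verified Lean document; each statement's English description precedes it below -/
import Mathlib

section
/- Let p, q ∈ ℂ[z] be polynomials without multiple roots, each of degree at least 2. If the Lie algebras ⟨LND(D_p)⟩ and ⟨LND(D_q)⟩ are isomorphic, then the Danielewski surfaces D_p and D_q are isomorphic as varieties, i.e. O(D_p) and O(D_q) are isomorphic as ℂ-algebras. -/
open Polynomial

set_option synthInstance.maxHeartbeats 400000
set_option maxHeartbeats 800000

noncomputable section

/-- The polynomial ring `ℂ[x,y,z]` (variables indexed by `Fin 3`). -/
abbrev P3 : Type := MvPolynomial (Fin 3) ℂ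

/-- The variable `x`. -/
def xP : P3 := MvPolynomial.X 0
/-- The variable `y`. -/
def yP : P3 := MvPolynomial.X 1
/-- The variable `z`. -/
def zP : P3 := MvPolynomial.X 2

/-- The ideal `(xy - p(z)) ⊆ ℂ[x,y,z]`. -/
def relIdeal (p : ℂ[X]) : Ideal P3 := Ideal.span {xP * yP - Polynomial.aeval zP p}

/-- The coordinate ring `O(D_p) = ℂ[x,y,z]/(xy - p(z))` of the Danielewski surface `D_p`. -/
abbrev ODan (p : ℂ[X]) : Type := P3 ⧸ relIdeal p

/-- A derivation is locally nilpotent if some power of it kills each element. -/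
def IsLND {p : ℂ[X]} (δ : Derivation ℂ (ODan p) (ODan p)) : Prop :=
  ∀ f : ODan p, ∃ n : ℕ, 1 ≤ n ∧ (δ.toLinearMap ^ n) f = 0

/-- The Lie subalgebra `⟨LND(D_p)⟩` of `Der_ℂ(O(D_p))` generated by all locally
nilpotent derivations. -/
def lndSpan (p : ℂ[X]) : LieSubalgebra ℂ (Derivation ℂ (ODan p) (ODan p)) :=
  LieSubalgebra.lieSpan ℂ _ {δ | IsLND δ}

section part1
/-- normality in a convenient form -/
theorem intlem {D S : Type} [CommRing D] [IsDomain D] [IsIntegrallyClosed D] [Algebra ℂ D]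
    [CommRing S] [IsDomain S] [Algebra ℂ S] (ψ : D →ₐ[ℂ] S) (hψ : Function.Injective ψ)
    (w : S) (a b r : D) (hb : b ≠ 0) (hab : ψ b * w = ψ a) (P : ℂ[X]) (hP : 1 ≤ P.natDegree)
    (hr : aeval w P = ψ r) : ∃ c, ψ c = w := by
  let K := FractionRing D
  let F := FractionRing S
  let g : D →+* F := (algebraMap S F).comp ψ.toRingHom
  have hg : Function.Injective g := (IsFractionRing.injective S F).comp hψ
  let m : K →+* F := IsFractionRing.lift hg
  have hm : ∀ d, m (algebraMap D K d) = algebraMap S F (ψ d) := fun d =>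
    IsFractionRing.lift_algebraMap hg d
  have hbK : algebraMap D K b ≠ 0 := by
    simpa using hb
  set wK : K := algebraMap D K a / algebraMap D K b with hwK
  have h1 : m wK = algebraMap S F w := by
    rw [hwK, map_div₀, hm, hm, ← hab, map_mul]
    have : algebraMap S F (ψ b) ≠ 0 := by
      rw [← hm]; exact (map_ne_zero m).2 hbK
    exact mul_div_cancel_left₀ _ this
  have h2 : aeval wK P = algebraMap D K r := by
    apply m.injective
    rw [hm, ← hr]
    rw [aeval_def, aeval_def, hom_eval₂, hom_eval₂, h1]
    congr 1
    ext c
    change m (algebraMap ℂ K c) = algebraMap S F (algebraMap ℂ S c)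
    rw [IsScalarTower.algebraMap_apply ℂ D K, hm, AlgHom.commutes]
  have hInteg : IsIntegral D wK := by
    have hP0 : P.leadingCoeff ≠ 0 := by
      intro h; rw [leadingCoeff_eq_zero] at h; simp [h] at hP
    have hPne : P ≠ 0 := by
      intro h; simp [h] at hP0
    refine ⟨(P * C (P.leadingCoeff)⁻¹).map (algebraMap ℂ D) - C ((P.leadingCoeff)⁻¹ • r), ?_, ?_⟩
    · apply Monic.sub_of_left
      · exact (monic_mul_leadingCoeff_inv hPne).map _
      · refine lt_of_le_of_lt degree_C_le ?_
        have : (P * C (P.leadingCoeff)⁻¹).natDegree = P.natDegree := by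
          rw [natDegree_mul_C (inv_ne_zero hP0)]
        rw [(monic_mul_leadingCoeff_inv hPne).degree_map]
        rw [← natDegree_pos_iff_degree_pos, this]; omega
    · rw [eval₂_sub, eval₂_C, eval₂_map, ← IsScalarTower.algebraMap_eq, ← aeval_def, map_mul, h2,
        aeval_C, Algebra.smul_def, map_mul, ← IsScalarTower.algebraMap_apply, mul_comm, sub_self]
  obtain ⟨c, hc⟩ := IsIntegrallyClosed.isIntegral_iff.1 hInteg
  refine ⟨c, IsFractionRing.injective S F ?_⟩
  rw [← hm, hc, h1]

variable {A : Type} [CommRing A] [Algebra ℂ A]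

def LN (δ : Derivation ℂ A A) : Prop := ∀ f, ∃ n : ℕ, δ^[n] f = 0

theorem iter_zero (δ : Derivation ℂ A A) (n : ℕ) : δ^[n] 0 = 0 := by
  induction n with
  | zero => rfl
  | succ n ih => rw [Function.iterate_succ_apply, map_zero, ih]

theorem iter_mono (δ : Derivation ℂ A A) {n m : ℕ} (h : n ≤ m) {f : A} (hf : δ^[n] f = 0) :
    δ^[m] f = 0 := by
  obtain ⟨k, rfl⟩ := Nat.exists_eq_add_of_le h
  rw [add_comm, Function.iterate_add_apply, hf, iter_zero]

theorem iter_add (δ : Derivation ℂ A A) (n : ℕ) (f g : A) : δ^[n] (f + g) = δ^[n] f + δ^[n] g := by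
  induction n generalizing f g with
  | zero => rfl
  | succ n ih => simp only [Function.iterate_succ_apply, map_add, ih]

theorem iter_smul (δ : Derivation ℂ A A) (n : ℕ) (c : ℂ) (g : A) : δ^[n] (c • g) = c • δ^[n] g := by
  induction n generalizing g with
  | zero => rfl
  | succ n ih => simp only [Function.iterate_succ_apply, Derivation.map_smul, ih]

/-- elements killed by a power of a derivation -/
def nilAlg (δ : Derivation ℂ A A) : Subalgebra ℂ A where
  carrier := {f | ∃ n : ℕ, δ^[n] f = 0}
  mul_mem' := by
    rintro f g ⟨n, hn⟩ ⟨m, hm⟩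
    refine ⟨n + m, ?_⟩
    have key : ∀ N n m : ℕ, n + m = N → ∀ f g, δ^[n] f = 0 → δ^[m] g = 0 → δ^[N] (f * g) = 0 := by
      intro N
      induction N with
      | zero =>
        intro n m h f g hf hg
        obtain rfl : n = 0 := by omega
        have : f = 0 := hf
        simp [this]
      | succ N ih =>
        intro n m h f g hf hg
        rw [Function.iterate_succ_apply, Derivation.leibniz, iter_add, smul_eq_mul, smul_eq_mul]
        have e1 : δ^[N] (f * δ g) = 0 := by
          rcases m with _ | m
          · have : g = 0 := hg
            simp [this, iter_zero]
          · exact ih n m (by omega) f _ hf hg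
        have e2 : δ^[N] (g * δ f) = 0 := by
          rcases n with _ | n
          · have : f = 0 := hf
            simp [this, iter_zero]
          · rw [mul_comm]; exact ih n m (by omega) _ g hf hg
        rw [e1, e2, add_zero]
    exact key _ n m rfl f g hn hm
  add_mem' := by
    rintro f g ⟨n, hn⟩ ⟨m, hm⟩
    refine ⟨n + m, ?_⟩
    rw [iter_add, iter_mono δ (by omega) hn, iter_mono δ (by omega) hm, add_zero]
  algebraMap_mem' := by
    intro c
    exact ⟨1, by simp⟩

theorem mem_nilAlg {δ : Derivation ℂ A A} {f : A} : f ∈ nilAlg δ ↔ ∃ n : ℕ, δ^[n] f = 0 := Iff.rfl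

theorem nilAlg_of_apply {δ : Derivation ℂ A A} {f : A} (h : δ f ∈ nilAlg δ) : f ∈ nilAlg δ := by
  obtain ⟨n, hn⟩ := h
  exact ⟨n + 1, hn⟩

theorem leibniz_iter (δ : Derivation ℂ A A) (n : ℕ) (a b : A) :
    δ^[n] (a * b) = ∑ ij ∈ Finset.HasAntidiagonal.antidiagonal n,
      ((n.choose ij.1 : ℕ) : A) * (δ^[ij.1] a * δ^[ij.2] b) := by
  induction n with
  | zero => simp
  | succ n ih =>
    rw [Finset.sum_antidiagonal_choose_succ_mul (fun i j => δ^[i] a * δ^[j] b) n,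
      Function.iterate_succ_apply', ih, map_sum, ← Finset.sum_add_distrib]
    apply Finset.sum_congr rfl
    rintro ⟨i, j⟩ hij
    have hc : n.choose i = n.choose j := by
      rw [Finset.HasAntidiagonal.mem_antidiagonal] at hij
      simp only at hij
      subst hij
      rw [Nat.choose_symm_add]
    simp only [Derivation.leibniz, smul_eq_mul, Derivation.map_natCast, Function.iterate_succ_apply',
      hc]
    ring

/-- exponential as power series -/
def expS (δ : Derivation ℂ A A) : A →ₐ[ℂ] PowerSeries A where
  toFun a := PowerSeries.mk fun n => ((n.factorial : ℂ)⁻¹) • δ^[n] a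
  map_one' := by
    ext n
    rcases n with _ | n
    · simp
    · simp [iter_zero, PowerSeries.coeff_one]
  map_zero' := by ext n; simp [iter_zero]
  map_add' a b := by ext n; simp [iter_add, smul_add]
  map_mul' a b := by
    ext n
    rw [PowerSeries.coeff_mul, PowerSeries.coeff_mk, leibniz_iter, Finset.smul_sum]
    apply Finset.sum_congr rfl
    rintro ⟨i, j⟩ hij
    rw [Finset.HasAntidiagonal.mem_antidiagonal] at hij
    simp only at hij
    subst hij
    simp only [PowerSeries.coeff_mk]
    rw [smul_mul_smul_comm, ← nsmul_eq_mul, ← Nat.cast_smul_eq_nsmul ℂ, smul_smul]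
    congr 1
    rw [Nat.choose_symm_add, Nat.add_choose]
    have h := Nat.factorial_mul_factorial_dvd_factorial_add i j
    have h1 : ((i + j).factorial : ℂ) ≠ 0 := by exact_mod_cast Nat.factorial_ne_zero _
    have h2 : ((i).factorial : ℂ) ≠ 0 := by exact_mod_cast Nat.factorial_ne_zero _
    have h3 : ((j).factorial : ℂ) ≠ 0 := by exact_mod_cast Nat.factorial_ne_zero _
    rw [Nat.cast_div h (by push_cast; exact mul_ne_zero h2 h3)]
    push_cast
    field_simp
  commutes' c := by
    ext n
    rcases n with _ | n
    · simp [PowerSeries.algebraMap_apply]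
    · simp [iter_zero, PowerSeries.algebraMap_apply, PowerSeries.coeff_C]

theorem coeff_expS (δ : Derivation ℂ A A) (n : ℕ) (a : A) :
    PowerSeries.coeff n (expS δ a) = ((n.factorial : ℂ)⁻¹) • δ^[n] a := by
  simp [expS]

theorem expS_poly (δ : Derivation ℂ A A) (a : A) :
    (∃ Q : A[X], (Q : PowerSeries A) = expS δ a) ↔ a ∈ nilAlg δ := by
  constructor
  · rintro ⟨Q, hQ⟩
    refine ⟨Q.natDegree + 1, ?_⟩
    have := congrArg (PowerSeries.coeff (Q.natDegree + 1)) hQ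
    rw [Polynomial.coeff_coe, coeff_eq_zero_of_natDegree_lt (by omega), coeff_expS] at this
    have h1 : ((Q.natDegree + 1).factorial : ℂ)⁻¹ ≠ 0 :=
      inv_ne_zero (by exact_mod_cast Nat.factorial_ne_zero _)
    exact (smul_eq_zero_iff_right h1).1 this.symm
  · rintro ⟨n, hn⟩
    refine ⟨PowerSeries.trunc n (expS δ a), ?_⟩
    ext m
    rw [Polynomial.coeff_coe, PowerSeries.coeff_trunc]
    split_ifs with h
    · rfl
    · rw [coeff_expS, iter_mono δ (by omega) hn, smul_zero]

theorem mem_nil_of_integral [IsDomain A] (δ : Derivation ℂ A A)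
    (w a b r : A) (hb : b ≠ 0) (hab : b * w = a) (P : ℂ[X]) (hP : 1 ≤ P.natDegree)
    (hr : aeval w P = r) (ha' : a ∈ nilAlg δ) (hb' : b ∈ nilAlg δ) (hr' : r ∈ nilAlg δ) :
    w ∈ nilAlg δ := by
  let K := FractionRing A
  have hinjK : Function.Injective (algebraMap A K) := IsFractionRing.injective A K
  let μ : PowerSeries A →ₐ[ℂ] PowerSeries K :=
    { PowerSeries.map (algebraMap A K) with
      commutes' := by
        intro c
        simp [PowerSeries.algebraMap_apply]
        rfl }
  have hμ : ∀ f n, PowerSeries.coeff n (μ f) = algebraMap A K (PowerSeries.coeff n f) := by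
    intro f n; exact PowerSeries.coeff_map _ _ _
  let ι : K[X] →ₐ[ℂ] PowerSeries K :=
    { Polynomial.coeToPowerSeries.ringHom with
      commutes' := by
        intro c
        simp [PowerSeries.algebraMap_apply, Polynomial.algebraMap_apply] }
  have hι : ∀ f, ι f = (f : PowerSeries K) := fun f => rfl
  have hιi : Function.Injective ι := Polynomial.coe_injective K
  have lift : ∀ f ∈ nilAlg δ, ∃ Q : K[X], ι Q = μ (expS δ f) := by
    intro f hf
    obtain ⟨Q, hQ⟩ := (expS_poly δ f).2 hf
    refine ⟨Q.map (algebraMap A K), ?_⟩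
    ext n
    rw [hι, hμ, ← hQ]; simp
  obtain ⟨qa, hqa⟩ := lift a ha'
  obtain ⟨qb, hqb⟩ := lift b hb'
  obtain ⟨qr, hqr⟩ := lift r hr'
  obtain ⟨c, hc⟩ := intlem ι hιi (μ (expS δ w)) qa qb qr (by
      rintro rfl
      rw [map_zero] at hqb
      have := congrArg (PowerSeries.coeff 0) hqb
      rw [hμ, coeff_expS] at this
      have h3 : algebraMap A K b = 0 := by simpa using this.symm
      exact hb (hinjK (by rw [h3, map_zero]))) (by
      rw [hqb, hqa, ← map_mul, ← map_mul, hab]) P hP (by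
      rw [hqr, ← hr, aeval_algHom_apply, aeval_algHom_apply])
  refine ⟨c.natDegree + 1, ?_⟩
  have := congrArg (PowerSeries.coeff (c.natDegree + 1)) hc
  rw [hι, Polynomial.coeff_coe, coeff_eq_zero_of_natDegree_lt (by omega), hμ, coeff_expS] at this
  have h0 : (((c.natDegree+1).factorial:ℂ)⁻¹) • δ^[c.natDegree+1] w = 0 :=
    hinjK (by rw [map_zero]; exact this.symm)
  rcases smul_eq_zero.1 h0 with h | h
  · exact absurd h (inv_ne_zero (by exact_mod_cast Nat.factorial_ne_zero _))
  · exact h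

theorem ln_eigen [IsDomain A] (δ : Derivation ℂ A A) (h : LN δ) (v g : A) (hv : δ v = g * v) :
    δ v = 0 := by
  obtain ⟨V, hV⟩ := (expS_poly δ v).2 (h v)
  obtain ⟨G, hG⟩ := (expS_poly δ g).2 (h g)
  obtain ⟨W, hW⟩ := (expS_poly δ (δ v)).2 (h _)
  have h1 : W = G * V := by
    apply Polynomial.coe_injective A
    rw [Polynomial.coe_mul, hW, hG, hV, ← map_mul, hv]
  have h2 : W = derivative V := by
    apply Polynomial.coe_injective A
    ext n
    rw [hW, coeff_expS, Polynomial.coeff_coe, coeff_derivative, ← Polynomial.coeff_coe, hV,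
      coeff_expS, Function.iterate_succ_apply]
    have h1 : ((n+1 : ℕ) : ℂ) ≠ 0 := by exact_mod_cast (Nat.succ_ne_zero n)
    have h2 : ((n).factorial : ℂ) ≠ 0 := by exact_mod_cast Nat.factorial_ne_zero _
    have : ((n : A) + 1) = algebraMap ℂ A ((n + 1 : ℕ) : ℂ) := by simp
    rw [this, mul_comm, ← Algebra.smul_def, smul_smul]
    congr 1
    rw [Nat.factorial_succ]; push_cast at h1 ⊢; field_simp
  have h3 : derivative V = 0 := by
    by_contra hne
    have hV0 : V.natDegree ≠ 0 := by
      intro h0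
      rw [natDegree_eq_zero] at h0
      obtain ⟨c, rfl⟩ := h0
      simp at hne
    have hlt := natDegree_derivative_lt hV0
    rw [← h2, h1] at hlt hne
    have hG0 : G ≠ 0 := left_ne_zero_of_mul hne
    have hV0 : V ≠ 0 := right_ne_zero_of_mul hne
    rw [natDegree_mul hG0 hV0] at hlt
    omega
  rw [← h2] at h3
  have := congrArg (PowerSeries.coeff 0) hW
  rw [h3, coeff_expS] at this
  simpa using this.symm
end part1

section part2
/-- The abstract package of facts about a Danielewski surface used in the proof. -/
structure DanData (p : ℂ[X]) (A : Type) [CommRing A] [Algebra ℂ A] where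
  θ : A →ₗ[ℂ] Derivation ℂ A A
  skew : ∀ f g, θ f g = - θ g f
  jac : ∀ f g, θ (θ f g) = ⁅θ f, θ g⁆
  pluck : ∀ a b c e, θ a b * θ c e - θ a c * θ b e + θ a e * θ b c = 0
  ker : ∀ f, θ f = 0 → ∃ c, f = algebraMap ℂ A c
  noone : ∀ c : ℂ, algebraMap ℂ A c ∈ Submodule.span ℂ {h | ∃ f g, h = θ f g} → c = 0
  x : A
  y : A
  z : A
  x0 : x ≠ 0
  xy : x * y = aeval z p
  gen : Algebra.adjoin ℂ {x, y, z} = ⊤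
  zx : θ z x = x
  kerx : ∀ g, θ x g = 0 → ∃ P : ℂ[X], g = aeval x P
  ham : ∀ δ : Derivation ℂ A A, LN δ → ∃ f, δ = θ f
  univ : ∀ (B : Type) [CommRing B] [Algebra ℂ B] (t s Z : B), t * s = aeval Z p →
    ∃ ψ : A →ₐ[ℂ] B, ψ x = t ∧ ψ y = s ∧ ψ z = Z
  deg : 2 ≤ p.natDegree

theorem LN_smul {A : Type} [CommRing A] [Algebra ℂ A] (δ : Derivation ℂ A A) (h : LN δ) (g : A)
    (hg : δ g = 0) : LN (g • δ) := by
  intro f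
  have key : ∀ n : ℕ, (g • δ)^[n] f = g ^ n * δ^[n] f := by
    intro n
    induction n with
    | zero => simp
    | succ n ih =>
      rw [Function.iterate_succ_apply', ih, Function.iterate_succ_apply', Derivation.smul_apply,
        Derivation.leibniz, Derivation.leibniz_pow, hg]
      simp [pow_succ]; ring
  obtain ⟨n, hn⟩ := h f
  exact ⟨n, by rw [key, hn, mul_zero]⟩

theorem LN_zero {A : Type} [CommRing A] [Algebra ℂ A] : LN (0 : Derivation ℂ A A) :=
  fun f => ⟨1, by simp⟩

theorem poly_top (G : Submodule ℂ ℂ[X]) (h : ∀ e : ℕ, ∃ g ∈ G, g ≠ 0 ∧ g.natDegree = e) :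
    G = ⊤ := by
  have key : ∀ n : ℕ, ∀ f : ℂ[X], f.degree < n → f ∈ G := by
    intro n
    induction n with
    | zero =>
      intro f hf
      have : f = 0 := by
        rw [← degree_eq_bot]
        by_contra hne
        rw [degree_eq_bot] at hne
        rw [degree_eq_natDegree hne] at hf
        simp at hf
      rw [this]; exact G.zero_mem
    | succ n ih =>
      intro f hf
      obtain ⟨g, hg, hg0, hgn⟩ := h n
      have hlc : g.leadingCoeff ≠ 0 := leadingCoeff_ne_zero.2 hg0
      have h1 : f - (f.coeff n / g.leadingCoeff) • g ∈ G := by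
        apply ih
        rw [degree_lt_iff_coeff_zero]
        intro m hm
        rw [coeff_sub, coeff_smul, smul_eq_mul]
        rcases hm.eq_or_lt with rfl | hlt
        · have : g.coeff n = g.leadingCoeff := by rw [leadingCoeff, hgn]
          rw [this, div_mul_cancel₀ _ hlc, sub_self]
        · rw [coeff_eq_zero_of_natDegree_lt (p := g) (by omega),
            coeff_eq_zero_of_degree_lt (p := f), mul_zero, sub_zero]
          refine lt_of_lt_of_le hf ?_
          exact_mod_cast hlt
      have := G.add_mem h1 (G.smul_mem (f.coeff n / g.leadingCoeff) hg)
      simpa using this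
  rw [eq_top_iff]
  intro f _
  exact key (f.natDegree + 1) f (lt_of_le_of_lt degree_le_natDegree (by exact_mod_cast Nat.lt_succ_self _))

theorem natDeg_iter (q : ℂ[X]) (k : ℕ) (hk : k ≤ q.natDegree) (hq : q ≠ 0) :
    derivative^[k] q ≠ 0 ∧ (derivative^[k] q).natDegree = q.natDegree - k := by
  induction k with
  | zero => simp [hq]
  | succ k ih =>
    obtain ⟨h1, h2⟩ := ih (by omega)
    rw [Function.iterate_succ_apply']
    have h3 : (derivative (derivative^[k] q)).natDegree = (derivative^[k] q).natDegree - 1 :=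
      natDegree_eq_of_degree_eq_some (degree_derivative_eq _ (by omega))
    refine ⟨?_, by rw [h3, h2]; omega⟩
    intro h0
    have := natDegree_eq_zero_of_derivative_eq_zero h0
    omega

namespace DanData
variable {p : ℂ[X]} {A : Type} [CommRing A] [Algebra ℂ A] [IsDomain A] (D : DanData p A)

theorem self (f : A) : D.θ f f = 0 := by
  have h := D.skew f f
  have : (2 : ℂ) • D.θ f f = 0 := by
    rw [two_smul]; nth_rw 2 [h]; simp
  exact (smul_eq_zero.1 this).resolve_left two_ne_zero

theorem θc (c : ℂ) : D.θ (algebraMap ℂ A c) = 0 := by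
  ext g
  rw [D.skew]; simp

theorem θmul (f g : A) : D.θ (f * g) = f • D.θ g + g • D.θ f := by
  ext h
  rw [D.skew, Derivation.leibniz, D.skew h f, D.skew h g]
  simp; ring

theorem θpow (f : A) (n : ℕ) : D.θ (f ^ n) = ((n : A) * f ^ (n - 1)) • D.θ f := by
  ext h
  rw [D.skew, Derivation.leibniz_pow, D.skew h f]
  simp [mul_assoc]

theorem θaeval (f : A) (P : ℂ[X]) : D.θ (aeval f P) = (aeval f (derivative P)) • D.θ f := by
  ext h
  rw [D.skew, Derivation.map_aeval, D.skew h f]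
  simp

theorem xz : D.θ D.x D.z = - D.x := by rw [D.skew, D.zx]

theorem zy : D.θ D.z D.y = - D.y := by
  have h : D.θ D.z (D.x * D.y) = 0 := by
    rw [D.xy, Derivation.map_aeval, D.self, smul_zero]
  rw [Derivation.leibniz, D.zx, smul_eq_mul, smul_eq_mul] at h
  apply mul_left_cancel₀ D.x0
  linear_combination h

theorem xyb : D.θ D.x D.y = - aeval D.z (derivative p) := by
  have h : D.θ D.x (D.x * D.y) = aeval D.z (derivative p) * (- D.x) := by
    rw [D.xy, Derivation.map_aeval, D.xz, smul_eq_mul]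
  rw [Derivation.leibniz, D.self, smul_eq_mul, smul_eq_mul] at h
  apply mul_left_cancel₀ D.x0
  linear_combination h

theorem ln_of_gens (δ : Derivation ℂ A A) (hx : D.x ∈ nilAlg δ) (hy : D.y ∈ nilAlg δ)
    (hz : D.z ∈ nilAlg δ) : LN δ := by
  have : (⊤ : Subalgebra ℂ A) ≤ nilAlg δ := by
    rw [← D.gen]
    apply Algebra.adjoin_le
    rintro f (rfl | rfl | rfl)
    · exact hx
    · exact hy
    · exact hz
  intro f
  exact this (Algebra.mem_top (x := f))

theorem aeval_mem (S : Subalgebra ℂ A) (f : A) (hf : f ∈ S) (P : ℂ[X]) : aeval f P ∈ S := by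
  have := aeval_mem_adjoin_singleton ℂ f (p := P)
  exact (Algebra.adjoin_le (by simpa using hf)) this

theorem lnx : LN (D.θ D.x) := by
  have hx : D.x ∈ nilAlg (D.θ D.x) := nilAlg_of_apply (by rw [D.self]; exact zero_mem _)
  have hz : D.z ∈ nilAlg (D.θ D.x) := nilAlg_of_apply (by rw [D.xz]; exact neg_mem hx)
  have hy : D.y ∈ nilAlg (D.θ D.x) := nilAlg_of_apply (by
    rw [D.xyb]; exact neg_mem (aeval_mem _ _ hz _))
  exact D.ln_of_gens _ hx hy hz

theorem lny : LN (D.θ D.y) := by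
  have hy : D.y ∈ nilAlg (D.θ D.y) := nilAlg_of_apply (by rw [D.self]; exact zero_mem _)
  have hz : D.z ∈ nilAlg (D.θ D.y) := nilAlg_of_apply (by rw [D.skew, D.zy, neg_neg]; exact hy)
  have hx : D.x ∈ nilAlg (D.θ D.y) := nilAlg_of_apply (by
    rw [D.skew, D.xyb, neg_neg]; exact (aeval_mem _ _ hz _))
  exact D.ln_of_gens _ hx hy hz

theorem ln_pow (f : A) (h : LN (D.θ f)) (n : ℕ) : LN (D.θ (f ^ n)) := by
  rw [D.θpow]
  apply LN_smul _ h
  rw [Derivation.leibniz, Derivation.leibniz_pow, D.self]; simp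

/-- the Lie algebra generated by LNDs -/
def L (D : DanData p A) : LieSubalgebra ℂ (Derivation ℂ A A) :=
  LieSubalgebra.lieSpan ℂ _ {δ | LN δ}

theorem L_of_ln {δ : Derivation ℂ A A} (h : LN δ) : δ ∈ D.L := LieSubalgebra.subset_lieSpan h

theorem L_bracket {f g : A} (hf : D.θ f ∈ D.L) (hg : D.θ g ∈ D.L) : D.θ (D.θ f g) ∈ D.L := by
  rw [D.jac]; exact D.L.lie_mem hf hg

theorem L_ham {δ : Derivation ℂ A A} (h : δ ∈ D.L) : ∃ f, δ = D.θ f := by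
  have : D.L ≤ { LinearMap.range D.θ with
    lie_mem' := by
      rintro _ _ ⟨f, rfl⟩ ⟨g, rfl⟩
      exact ⟨D.θ f g, D.jac f g⟩ } := by
    rw [L, LieSubalgebra.lieSpan_le]
    intro δ hδ
    obtain ⟨f, hf⟩ := D.ham δ hδ
    exact ⟨f, hf.symm⟩
  obtain ⟨f, hf⟩ := this h
  exact ⟨f, hf.symm⟩

/-- Hamiltonians of elements of the Lie algebra -/
def Λ (D : DanData p A) : Submodule ℂ A := D.L.toSubmodule.comap D.θ

theorem mem_Λ {f : A} : f ∈ D.Λ ↔ D.θ f ∈ D.L := Iff.rfl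

theorem Λ_br {f g : A} (hf : f ∈ D.Λ) (hg : g ∈ D.Λ) : D.θ f g ∈ D.Λ := D.L_bracket hf hg

theorem xn_Λ (n : ℕ) : D.x ^ n ∈ D.Λ := D.L_of_ln (D.ln_pow _ D.lnx n)
theorem x_Λ : D.x ∈ D.Λ := D.L_of_ln D.lnx
theorem y_Λ : D.y ∈ D.Λ := D.L_of_ln D.lny
theorem yn_Λ (n : ℕ) : D.y ^ n ∈ D.Λ := D.L_of_ln (D.ln_pow _ D.lny n)

theorem x_br (n : ℕ) (g : ℂ[X]) :
    D.θ D.x (D.x ^ n * aeval D.z g) = - (D.x ^ (n + 1) * aeval D.z (derivative g)) := by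
  rw [Derivation.leibniz, Derivation.leibniz_pow, D.self, Derivation.map_aeval, D.xz]
  simp; ring

theorem mem1 (n' j : ℕ) (hj : 1 ≤ j) :
    D.x ^ n' * aeval D.z (derivative (p ^ j)) ∈ D.Λ := by
  have h := D.Λ_br (D.xn_Λ (n' + j)) (D.yn_Λ j)
  obtain ⟨j, rfl⟩ : ∃ i, j = i + 1 := ⟨j - 1, by omega⟩
  have e : D.θ (D.x ^ (n' + (j + 1))) (D.y ^ (j + 1)) =
      (-((n' + (j + 1) : ℕ) : ℂ)) • (D.x ^ n' * aeval D.z (derivative (p ^ (j + 1)))) := by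
    rw [D.θpow, Derivation.leibniz_pow, Derivation.smul_apply, D.xyb, derivative_pow]
    simp only [smul_eq_mul, nsmul_eq_mul]
    simp only [map_mul, map_pow, ← D.xy, Algebra.smul_def, map_neg, map_natCast, aeval_C]
    simp only [Nat.add_sub_cancel, ← add_assoc, nsmul_eq_mul]
    ring
  rw [e] at h
  have hne : (-((n' + (j + 1) : ℕ) : ℂ)) ≠ 0 := by
    rw [neg_ne_zero]; exact Nat.cast_ne_zero.2 (by omega)
  exact (D.Λ.smul_mem_iff hne).1 h

theorem mem2 (k j n : ℕ) (hj : 1 ≤ j) (hn : k ≤ n) :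
    D.x ^ n * aeval D.z (derivative^[k + 1] (p ^ j)) ∈ D.Λ := by
  induction k generalizing n with
  | zero => exact D.mem1 n j hj
  | succ k ih =>
    obtain ⟨n, rfl⟩ : ∃ i, n = i + 1 := ⟨n - 1, by omega⟩
    have h := D.Λ_br D.x_Λ (ih n (by omega))
    rw [D.x_br, ← Function.iterate_succ_apply' (f := derivative)] at h
    exact (neg_mem_iff).1 h

/-- the threshold -/
def N (D : DanData p A) : ℕ := p.natDegree

theorem mem3 (n : ℕ) (hn : D.N ≤ n) (g : ℂ[X]) : D.x ^ n * aeval D.z g ∈ D.Λ := by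
  let lin : ℂ[X] →ₗ[ℂ] A := (LinearMap.mulLeft ℂ (D.x ^ n)) ∘ₗ (aeval D.z).toLinearMap
  have : D.Λ.comap lin = ⊤ := by
    apply poly_top
    intro e
    have hd := D.deg
    set d := p.natDegree with hdd
    have hmod : e % d < d := Nat.mod_lt _ (by omega)
    have hdm := Nat.div_add_mod e d
    have hp0 : p ≠ 0 := by
      intro h; rw [h] at hdd; simp at hdd; omega
    have hpow : (p ^ (e / d + 1)).natDegree = d * (e / d) + d := by
      rw [natDegree_pow]; ring
    have hk : d - e % d - 1 + 1 ≤ (p ^ (e / d + 1)).natDegree := by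
      rw [hpow]; generalize d * (e / d) = u at *; omega
    have := natDeg_iter (p ^ (e / d + 1)) (d - e % d - 1 + 1) hk (pow_ne_zero _ hp0)
    refine ⟨_, D.mem2 (d - e % d - 1) (e / d + 1) n (Nat.succ_le_succ (Nat.zero_le _)) ?_, this.1, ?_⟩
    · have : d ≤ n := hn
      omega
    · rw [this.2, hpow]; clear hpow this hk; generalize d * (e / d) = u at *; omega
  have h : g ∈ D.Λ.comap lin := by rw [this]; trivial
  exact h

theorem mem4 (n k : ℕ) (hn : D.N ≤ n) : D.x ^ n * D.z ^ k ∈ D.Λ := by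
  have := D.mem3 n hn (X ^ k)
  simpa using this

/-- big elements -/
def M (D : DanData p A) : Submodule ℂ A :=
  Submodule.span ℂ {f | ∃ n k : ℕ, D.N + 1 ≤ n ∧ f = D.x ^ n * D.z ^ k}

theorem M_gen (n k : ℕ) (h : D.N + 1 ≤ n) : D.x ^ n * D.z ^ k ∈ D.M :=
  Submodule.subset_span ⟨n, k, h, rfl⟩

theorem M_poly (n : ℕ) (P : ℂ[X]) (h : D.N + 1 ≤ n) : D.x ^ n * aeval D.z P ∈ D.M := by
  rw [aeval_eq_sum_range, Finset.mul_sum]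
  apply Submodule.sum_mem
  intro i _
  rw [mul_smul_comm]
  exact D.M.smul_mem _ (D.M_gen n i h)

theorem M_le : D.M ≤ D.Λ := by
  rw [M, Submodule.span_le]
  rintro _ ⟨n, k, h, rfl⟩
  exact D.mem4 n k (by omega)

theorem M_mul {f g : A} (hf : f ∈ D.M) (hg : g ∈ D.M) : f * g ∈ D.M := by
  have := Submodule.mul_mem_mul hf hg
  rw [M, Submodule.span_mul_span] at this
  refine (Submodule.span_le.2 ?_) this
  rintro _ ⟨_, ⟨n, k, h, rfl⟩, _, ⟨n', k', h', rfl⟩, rfl⟩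
  have e : D.x ^ n * D.z ^ k * (D.x ^ n' * D.z ^ k') = D.x ^ (n + n') * D.z ^ (k + k') := by ring
  simp only [e]
  exact D.M_gen _ _ (by omega)

theorem M_big (f : A) : ∃ m0, ∀ m, m0 ≤ m → D.x ^ m * f ∈ D.M := by
  have hf : f ∈ Algebra.adjoin ℂ {D.x, D.y, D.z} := by rw [D.gen]; trivial
  induction hf using Algebra.adjoin_induction with
  | mem f hf =>
    rcases hf with rfl | rfl | rfl
    · refine ⟨D.N + 1, fun m hm => ?_⟩
      have := D.M_gen (m + 1) 0 (by omega)
      simpa [pow_succ] using this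
    · refine ⟨D.N + 2, fun m hm => ?_⟩
      obtain ⟨m, rfl⟩ : ∃ i, m = i + 1 := ⟨m - 1, by omega⟩
      rw [pow_succ, mul_assoc, D.xy]
      exact D.M_poly _ _ (by omega)
    · refine ⟨D.N + 1, fun m hm => ?_⟩
      have := D.M_gen m 1 (by omega)
      simpa using this
  | algebraMap c =>
    refine ⟨D.N + 1, fun m hm => ?_⟩
    have := D.M_poly m (C c) (by omega)
    simpa using this
  | add f g _ _ hf hg =>
    obtain ⟨a, ha⟩ := hf
    obtain ⟨b, hb⟩ := hg
    refine ⟨a + b, fun m hm => ?_⟩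
    rw [mul_add]
    exact add_mem (ha m (by omega)) (hb m (by omega))
  | mul f g _ _ hf hg =>
    obtain ⟨a, ha⟩ := hf
    obtain ⟨b, hb⟩ := hg
    refine ⟨a + b, fun m hm => ?_⟩
    have := D.M_mul (ha a le_rfl) (hb (m - a) (by omega))
    have e : D.x ^ m * (f * g) = D.x ^ a * f * (D.x ^ (m - a) * g) := by
      rw [show m = a + (m - a) by omega, pow_add]
      simp only [Nat.add_sub_cancel_left]; ring
    rw [e]; exact this

end DanData
end part2

section part3
section transfer
variable {p q : ℂ[X]} {A B : Type} [CommRing A] [Algebra ℂ A] [IsDomain A]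
  [CommRing B] [Algebra ℂ B] [IsDomain B]

/-- the span of all brackets -/
def DanData.S (E : DanData q B) : Submodule ℂ B := Submodule.span ℂ {h | ∃ f g, h = E.θ f g}

theorem DanData.S_br (E : DanData q B) (f g : B) : E.θ f g ∈ E.S :=
  Submodule.subset_span ⟨f, g, rfl⟩

theorem DanData.S_const (E : DanData q B) {f : B} (hf : f ∈ E.S) (h : E.θ f = 0) : f = 0 := by
  obtain ⟨c, rfl⟩ := E.ker f h
  rw [E.noone c hf, map_zero]

theorem DanData.θxi (D : DanData p A) (i : ℕ) : D.θ (D.x ^ (i + 1)) ≠ 0 := by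
  intro h
  rw [D.θpow] at h
  have := congrArg (fun d : Derivation ℂ A A => d D.z) h
  simp [D.xz, D.x0] at this
  have h2 : ((i + 1 : ℕ) : A) = algebraMap ℂ A ((i + 1 : ℕ) : ℂ) := by simp
  have h3 : ((i + 1 : ℕ) : A) = 0 := by push_cast; exact this
  rw [h2, map_eq_zero] at h3
  exact (Nat.cast_ne_zero.2 (Nat.succ_ne_zero i)) h3

/-- two Hamiltonians correspond to each other under the isomorphism -/
def HRel (D : DanData p A) (E : DanData q B) (φ : D.L ≃ₗ⁅ℂ⁆ E.L) (f : A) (g : B) : Prop :=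
  ∃ hf : D.θ f ∈ D.L, (φ ⟨D.θ f, hf⟩ : Derivation ℂ B B) = E.θ g

variable {D : DanData p A} {E : DanData q B} {φ : D.L ≃ₗ⁅ℂ⁆ E.L}

theorem HRel.memA {f g} (h : HRel D E φ f g) : f ∈ D.Λ := h.1
theorem HRel.memB {f g} (h : HRel D E φ f g) : g ∈ E.Λ := by
  obtain ⟨hf, h⟩ := h
  rw [DanData.mem_Λ, ← h]
  exact (φ _).2

theorem HRel.add {f g f' g'} (h : HRel D E φ f g) (h' : HRel D E φ f' g') :
    HRel D E φ (f + f') (g + g') := by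
  obtain ⟨hf, h⟩ := h
  obtain ⟨hf', h'⟩ := h'
  have hm : D.θ (f + f') ∈ D.L := by rw [map_add]; exact add_mem hf hf'
  have e : (⟨D.θ (f + f'), hm⟩ : D.L) = ⟨D.θ f, hf⟩ + ⟨D.θ f', hf'⟩ := Subtype.ext (map_add _ _ _)
  refine ⟨hm, ?_⟩
  rw [e, map_add, map_add E.θ, ← h, ← h']; rfl

theorem HRel.smul {f g} (c : ℂ) (h : HRel D E φ f g) : HRel D E φ (c • f) (c • g) := by
  obtain ⟨hf, h⟩ := h
  have hm : D.θ (c • f) ∈ D.L := by rw [map_smul]; exact D.L.smul_mem _ hf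
  have e : (⟨D.θ (c • f), hm⟩ : D.L) = c • ⟨D.θ f, hf⟩ := Subtype.ext (map_smul _ _ _)
  refine ⟨hm, ?_⟩
  rw [e, map_smul, map_smul E.θ, ← h]; rfl

theorem HRel.neg {f g} (h : HRel D E φ f g) : HRel D E φ (-f) (-g) := by
  have := h.smul (-1); simpa using this

theorem HRel.sub {f g f' g'} (h : HRel D E φ f g) (h' : HRel D E φ f' g') :
    HRel D E φ (f - f') (g - g') := by
  rw [sub_eq_add_neg, sub_eq_add_neg]; exact h.add h'.neg

theorem HRel.zero : HRel D E φ 0 0 := by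
  refine ⟨by rw [map_zero]; exact D.L.zero_mem, ?_⟩
  have : (⟨D.θ 0, by rw [map_zero]; exact D.L.zero_mem⟩ : D.L) = 0 := by ext1; simp
  rw [this]; simp

theorem HRel.br {f g f' g'} (h : HRel D E φ f g) (h' : HRel D E φ f' g') :
    HRel D E φ (D.θ f f') (E.θ g g') := by
  obtain ⟨hf, h⟩ := h
  obtain ⟨hf', h'⟩ := h'
  refine ⟨D.L_bracket hf hf', ?_⟩
  rw [E.jac, ← h, ← h', ← LieSubalgebra.coe_bracket, ← LieEquiv.map_lie]
  congr 2
  ext1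
  exact D.jac _ _

theorem HRel.ex {f} (h : f ∈ D.Λ) : ∃ g, HRel D E φ f g := by
  obtain ⟨g, hg⟩ := E.L_ham (φ ⟨D.θ f, h⟩).2
  exact ⟨g, h, hg⟩

theorem HRel.surj {g} (h : g ∈ E.Λ) : ∃ f, HRel D E φ f g := by
  obtain ⟨f, hf⟩ := D.L_ham (φ.symm ⟨E.θ g, h⟩).2
  refine ⟨f, by rw [← hf]; exact (φ.symm _).2, ?_⟩
  have : (⟨D.θ f, by rw [← hf]; exact (φ.symm _).2⟩ : D.L) = φ.symm ⟨E.θ g, h⟩ := by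
    ext1; exact hf.symm
  rw [this]; simp

theorem HRel.right_zero {f g} (h : HRel D E φ f g) (hf : D.θ f = 0) : E.θ g = 0 := by
  obtain ⟨hf', h⟩ := h
  rw [← h]
  have : (⟨D.θ f, hf'⟩ : D.L) = 0 := by ext1; exact hf
  rw [this]; simp

theorem HRel.left_zero {f g} (h : HRel D E φ f g) (hg : E.θ g = 0) : D.θ f = 0 := by
  obtain ⟨hf', h⟩ := h
  rw [hg] at h
  have h1 : φ ⟨D.θ f, hf'⟩ = 0 := by ext1; exact h
  have h2 : (⟨D.θ f, hf'⟩ : D.L) = 0 := by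
    apply φ.injective; exact h1.trans (map_zero φ).symm
  exact congrArg Subtype.val h2

theorem HRel.uniq {f g g'} (h : HRel D E φ f g) (h' : HRel D E φ f g') : E.θ g = E.θ g' := by
  have := (h.sub h').right_zero (by simp)
  rwa [map_sub, sub_eq_zero] at this

theorem HRel.congr {f g g'} (h : HRel D E φ f g) (h' : E.θ g = E.θ g') : HRel D E φ f g' :=
  ⟨h.1, h.2.trans h'⟩

theorem HRel.uniqS {f g g'} (h : HRel D E φ f g) (h' : HRel D E φ f g') (hg : g ∈ E.S)
    (hg' : g' ∈ E.S) : g = g' := by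
  have := (h.sub h').right_zero (by simp)
  exact sub_eq_zero.1 (E.S_const (sub_mem hg hg') this)

theorem HRel.const {f g} (h : HRel D E φ f g) (c : ℂ) : HRel D E φ f (g + algebraMap ℂ B c) :=
  h.congr (by rw [map_add, E.θc, add_zero])

theorem HRel.iter {f g f' g'} (h : HRel D E φ f g) (h' : HRel D E φ f' g') (n : ℕ) :
    HRel D E φ ((D.θ f)^[n] f') ((E.θ g)^[n] g') := by
  induction n with
  | zero => exact h'
  | succ n ih =>
    rw [Function.iterate_succ_apply', Function.iterate_succ_apply']
    exact h.br ih

theorem HRel.ln {f g} (h : HRel D E φ f g) (hf : LN (D.θ f)) : LN (E.θ g) := by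
  have h1 : ∀ k ∈ E.Λ, k ∈ nilAlg (E.θ g) := by
    intro k hk
    obtain ⟨k', hk'⟩ := HRel.surj (φ := φ) hk
    obtain ⟨n, hn⟩ := hf k'
    have := (h.iter hk' n)
    rw [hn] at this
    have h2 := this.right_zero (by simp)
    refine ⟨n + 1, ?_⟩
    rw [Function.iterate_succ_apply', E.skew, h2]; simp
  have hx := h1 _ E.x_Λ
  have hy := h1 _ E.y_Λ
  have hd := E.deg
  have hz : E.z ∈ nilAlg (E.θ g) := by
    refine mem_nil_of_integral _ E.z (E.x ^ E.N * E.z) (E.x ^ E.N) (E.x * E.y)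
      (pow_ne_zero _ E.x0) rfl q (by omega) E.xy.symm ?_ (h1 _ (E.xn_Λ _)) (mul_mem hx hy)
    have := E.mem4 E.N 1 le_rfl
    rw [pow_one] at this
    exact h1 _ this
  exact E.ln_of_gens _ hx hy hz

theorem LN.slice {δ : Derivation ℂ B B} (h : LN δ) (h0 : δ ≠ 0) : ∃ r, δ r ≠ 0 ∧ δ (δ r) = 0 := by
  obtain ⟨g, hg⟩ : ∃ g, δ g ≠ 0 := by
    by_contra hc
    push Not at hc
    exact h0 (by ext g; simpa using hc g)
  classical
  have hn := Nat.find_spec (h (δ g))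
  have hm := fun m => Nat.find_min (h (δ g)) (m := m)
  set n := Nat.find (h (δ g))
  rcases n with _ | n
  · exact absurd hn hg
  · refine ⟨δ^[n] g, ?_, ?_⟩
    · have h1 := hm n (by omega)
      rwa [← Function.iterate_succ_apply, Function.iterate_succ_apply'] at h1
    · rwa [← Function.iterate_succ_apply, Function.iterate_succ_apply',
        Function.iterate_succ_apply'] at hn

theorem LN_of_smul (δ : Derivation ℂ B B) (g : B) (hg0 : g ≠ 0)
    (hg : δ g = 0) (h : LN (g • δ)) : LN δ := by
  intro f
  have key : ∀ n : ℕ, (g • δ)^[n] f = g ^ n * δ^[n] f := by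
    intro n
    induction n with
    | zero => simp
    | succ n ih =>
      rw [Function.iterate_succ_apply', ih, Function.iterate_succ_apply', Derivation.smul_apply,
        Derivation.leibniz, Derivation.leibniz_pow, hg]
      simp [pow_succ]; ring
  obtain ⟨n, hn⟩ := h f
  rw [key] at hn
  exact ⟨n, (mul_eq_zero.1 hn).resolve_left (pow_ne_zero _ hg0)⟩

theorem alg_const (t : B) (R : ℂ[X]) (hR : R ≠ 0) (h : aeval t R = 0) :
    ∃ c, t = algebraMap ℂ B c := by
  have hi : IsIntegral ℂ t := (isAlgebraic_iff_isIntegral).1 ⟨R, hR, h⟩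
  have h1 := IsAlgClosed.degree_eq_one_of_irreducible ℂ (minpoly.irreducible hi)
  obtain ⟨c, hc⟩ := minpoly.mem_range_of_degree_eq_one ℂ t h1
  exact ⟨c, hc.symm⟩

theorem DanData.x2br (D : DanData p A) (i j n : ℕ) :
    D.θ (D.x ^ i) (D.θ (D.x ^ j) (D.x ^ n * D.z ^ 2)) =
      ((2 * i * j : ℕ) : ℂ) • D.x ^ (n + i + j) := by
  rcases i with _ | i
  · simp [show D.θ (1 : A) = 0 by simpa using D.θc 1]
  rcases j with _ | j
  · simp [show D.θ (1 : A) = 0 by simpa using D.θc 1]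
  simp only [D.θpow, Derivation.smul_apply, Derivation.leibniz, Derivation.leibniz_pow, D.self,
    D.xz, smul_eq_mul, nsmul_eq_mul, Algebra.smul_def, map_natCast, map_neg,
    Derivation.map_natCast]
  simp [D.self, D.xz, show D.θ D.x (2 : A) = 0 from Derivation.map_natCast (D.θ D.x) 2]
  ring

set_option maxHeartbeats 2000000 in
theorem stage3a [IsIntegrallyClosed B] (D : DanData p A) (E : DanData q B)
    (φ : D.L ≃ₗ⁅ℂ⁆ E.L) :
    ∃ (c : ℂ) (t : B), c ≠ 0 ∧ (∀ i : ℕ, HRel D E φ (D.x ^ i) (c • t ^ i)) ∧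
      (∀ g, E.θ t g = 0 → ∃ P : ℂ[X], g = aeval t P) ∧
      (∀ R : ℂ[X], aeval t R = 0 → R = 0) := by
  choose F hF using fun i : ℕ => HRel.ex (φ := φ) (D.xn_Λ i)
  have hF1 : HRel D E φ D.x (F 1) := by simpa using hF 1
  have hcomm : ∀ i j, E.θ (F i) (F j) = 0 := by
    intro i j
    refine E.S_const (E.S_br _ _) (((hF i).br (hF j)).right_zero ?_)
    rw [D.θpow, Derivation.smul_apply, Derivation.leibniz_pow, D.self]; simp
  set δ := E.θ (F 1) with hδ
  have hδln : LN δ := hF1.ln D.lnx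
  have hδ0 : δ ≠ 0 := by
    intro h
    have := hF1.left_zero h
    have h2 := D.θxi 0
    simp [this] at h2
  obtain ⟨r, hr, hr2⟩ := hδln.slice hδ0
  set b := δ r with hb
  let bi : ℕ → B := fun i => E.θ (F i) r
  have hbi1 : bi 1 = b := rfl
  have hpl : ∀ i g, b * E.θ (F i) g = bi i * δ g := by
    intro i g
    have := E.pluck (F i) (F 1) g r
    rw [hcomm] at this
    linear_combination -this
  have hFb : ∀ i, E.θ (F i) b = 0 := by
    intro i
    have := hpl i b
    rw [hr2, mul_zero] at this
    exact (mul_eq_zero.1 this).resolve_left hr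
  have hδF : ∀ i g, δ (E.θ (F i) g) = E.θ (F i) (δ g) := by
    intro i g
    have h1 := E.jac (F 1) (F i)
    rw [hcomm, map_zero] at h1
    have h2 := congrArg (fun d : Derivation ℂ B B => d g) h1
    simp only [Derivation.commutator_apply, Derivation.zero_apply] at h2
    exact (sub_eq_zero.1 h2.symm)
  have hδbi : ∀ i, δ (bi i) = 0 := by
    intro i
    change δ (E.θ (F i) r) = 0
    rw [hδF]; exact hFb i
  obtain ⟨h, hh⟩ := HRel.ex (φ := φ) (D.mem4 D.N 2 le_rfl)
  have hbr : ∀ i j, HRel D E φ (((2 * i * j : ℕ) : ℂ) • D.x ^ (D.N + i + j))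
      (E.θ (F i) (E.θ (F j) h)) := by
    intro i j
    have := (hF i).br ((hF j).br hh)
    rwa [D.x2br] at this
  have hd2 : δ (δ h) ≠ 0 := by
    intro h0
    have := hbr 1 1
    change HRel D E φ _ (δ (δ h)) at this
    rw [h0] at this
    have h2 := this.left_zero (by simp)
    rw [map_smul] at h2
    exact D.θxi (D.N + 1) ((smul_eq_zero.1 h2).resolve_left (by norm_num))
  have hbb : ∀ i j, b * b * E.θ (F i) (E.θ (F j) h) = bi i * bi j * δ (δ h) := by
    intro i j
    have e1 := hpl i (E.θ (F j) h)
    have e2 := congrArg δ (hpl j h)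
    rw [Derivation.leibniz, Derivation.leibniz, hr2, hδbi j] at e2
    simp only [smul_eq_mul, mul_zero, add_zero] at e2
    linear_combination b * e1 + bi i * e2
  have hrec : ∀ i : ℕ, (2 * i : B) * (b * bi (i + 1)) = ((i : B) + 1) * (bi 2 * bi i) := by
    intro i
    have r1 := (hbr 1 (i + 1)).smul (2 * i : ℂ)
    have r2 := (hbr 2 i).smul (i + 1 : ℂ)
    have e : (2 * i : ℂ) • (((2 * 1 * (i + 1) : ℕ) : ℂ) • D.x ^ (D.N + 1 + (i + 1))) =
      (i + 1 : ℂ) • (((2 * 2 * i : ℕ) : ℂ) • D.x ^ (D.N + 2 + i)) := by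
      rw [smul_smul, smul_smul, show D.N + 1 + (i + 1) = D.N + 2 + i by ring]
      congr 1
      push_cast; ring
    rw [e] at r1
    have e3 := r1.uniqS r2 (E.S.smul_mem _ (E.S_br _ _)) (E.S.smul_mem _ (E.S_br _ _))
    rw [Algebra.smul_def, Algebra.smul_def] at e3
    simp only [map_mul, map_ofNat, map_natCast, map_add, map_one] at e3
    have q1 := hbb 1 (i + 1)
    have q2 := hbb 2 i
    rw [hbi1] at q1
    apply mul_right_cancel₀ hd2
    linear_combination (-(2 * i : B)) * q1 + ((i : B) + 1) * q2 + b * b * e3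
  let K := FractionRing B
  have hinj : Function.Injective (algebraMap B K) := IsFractionRing.injective B K
  have hbK : algebraMap B K b ≠ 0 := by
    intro h; exact hr (hinj (by rw [h, map_zero]))
  have h2K : (2 : K) ≠ 0 := by
    have : (2 : K) = algebraMap ℂ K 2 := (map_ofNat (algebraMap ℂ K) 2).symm
    rw [this, _root_.map_ne_zero]; norm_num
  have natK : ∀ i : ℕ, ((i : K) + 1) ≠ 0 := by
    intro i
    have : ((i : K) + 1) = algebraMap ℂ K ((i + 1 : ℕ) : ℂ) := by simp
    rw [this, _root_.map_ne_zero]; exact Nat.cast_ne_zero.2 (Nat.succ_ne_zero i)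
  set u : K := algebraMap B K (bi 2) / (2 * algebraMap B K b) with hu
  have hu2 : algebraMap B K (bi 2) = 2 * algebraMap B K b * u := by
    rw [hu, mul_div_cancel₀]; exact mul_ne_zero h2K hbK
  have hbu : ∀ i : ℕ, algebraMap B K (bi (i + 1)) = (i + 1 : K) * u ^ i * algebraMap B K b := by
    intro i
    induction i with
    | zero => simp [hbi1]
    | succ i ih =>
      have := congrArg (algebraMap B K) (hrec (i + 1))
      simp only [map_mul, map_ofNat, map_natCast, map_add, map_one] at this
      rw [ih, hu2] at this
      have hne : (2 * (i + 1) : K) * algebraMap B K b ≠ 0 :=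
        mul_ne_zero (mul_ne_zero h2K (natK i)) hbK
      apply mul_left_cancel₀ hne
      push_cast at this ⊢
      linear_combination this
  have hbi0 : bi 0 = 0 := by
    have h1 := (hF 0).right_zero (by rw [pow_zero]; simpa using D.θc 1)
    change E.θ (F 0) r = 0
    rw [h1]; rfl
  have hbu' : ∀ i : ℕ, algebraMap B K (bi i) = (i : K) * u ^ (i - 1) * algebraMap B K b := by
    intro i
    rcases i with _ | i
    · simp [hbi0]
    · rw [hbu]; simp
  have hlin : ∀ P : ℂ[X], ∃ e, HRel D E φ (aeval D.x P) e ∧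
      algebraMap B K (E.θ e r) = algebraMap B K b * aeval u (derivative P) := by
    intro P
    induction P using Polynomial.induction_on' with
    | add P Q hP hQ =>
      obtain ⟨e, he, he'⟩ := hP
      obtain ⟨f, hf, hf'⟩ := hQ
      refine ⟨e + f, by rw [map_add]; exact he.add hf, ?_⟩
      simp only [map_add, Derivation.add_apply, he', hf']
      ring
    | monomial n a =>
      refine ⟨a • F n, ?_, ?_⟩
      · rw [aeval_monomial, ← Algebra.smul_def]
        exact (hF n).smul a
      · rw [map_smul, Derivation.smul_apply, derivative_monomial, aeval_monomial]
        change algebraMap B K (a • bi n) = _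
        rw [Algebra.smul_def, map_mul, hbu', ← IsScalarTower.algebraMap_apply]
        simp; ring
  have hcommP : ∀ e ∈ E.Λ, δ e = 0 → ∃ P : ℂ[X],
      algebraMap B K (E.θ e r) = algebraMap B K b * aeval u P := by
    intro e he hde
    obtain ⟨k, hk⟩ := HRel.surj (φ := φ) he
    have h1 := hF1.br hk
    change HRel D E φ _ (δ e) at h1
    rw [hde] at h1
    have h2 := D.S_const (D.S_br _ _) (h1.left_zero (by simp))
    obtain ⟨P, rfl⟩ := D.kerx k h2
    obtain ⟨e', he', h3⟩ := hlin P
    exact ⟨derivative P, by rw [hk.uniq he', h3]⟩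
  have hker : ∀ g, δ g = 0 → ∃ P : ℂ[X], algebraMap B K g = aeval u P := by
    intro g hg
    obtain ⟨e, he⟩ := E.ham _ (LN_smul δ hδln g hg)
    have hm : e ∈ E.Λ := by
      rw [DanData.mem_Λ, ← he]; exact E.L_of_ln (LN_smul δ hδln g hg)
    obtain ⟨P, hP⟩ := hcommP e hm (by
      rw [hδ, E.skew, ← he, Derivation.smul_apply, hδ, E.self]; simp)
    refine ⟨P, ?_⟩
    rw [← he, Derivation.smul_apply, smul_eq_mul, map_mul, ← hb, mul_comm] at hP
    exact mul_left_cancel₀ hbK hP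
  have hF1nc : ∀ c, F 1 ≠ algebraMap ℂ B c := by
    intro c hc
    exact hδ0 (by rw [hδ, hc, E.θc])
  obtain ⟨Q, hQ⟩ := hker (F 1) (by rw [hδ, E.self])
  have hQd : 1 ≤ Q.natDegree := by
    by_contra hlt
    have : Q.natDegree = 0 := by omega
    rw [natDegree_eq_zero] at this
    obtain ⟨c, rfl⟩ := this
    rw [aeval_C, IsScalarTower.algebraMap_apply ℂ B K] at hQ
    exact hF1nc c (hinj hQ)
  obtain ⟨t, ht⟩ := intlem (IsScalarTower.toAlgHom ℂ B K) hinj u (bi 2) (2 * b) (F 1)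
    (by
      intro h0
      have := congrArg (algebraMap B K) h0
      rw [map_mul, map_zero, map_ofNat] at this
      exact mul_ne_zero h2K hbK this)
    (by
      change algebraMap B K (2 * b) * u = algebraMap B K (bi 2)
      rw [hu2, map_mul, map_ofNat]) Q hQd hQ.symm
  replace ht : algebraMap B K t = u := ht
  have hBK : ∀ (P : ℂ[X]), aeval u P = algebraMap B K (aeval t P) := by
    intro P; rw [← ht, aeval_algebraMap_apply]
  have h2b : bi 2 = 2 * b * t := by
    apply hinj
    rw [hu2, map_mul, map_mul, map_ofNat, ht]
  have h2B : (2 : B) ≠ 0 := by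
    intro h0
    apply h2K
    have := congrArg (algebraMap B K) h0
    rwa [map_zero, map_ofNat] at this
  have hδt : δ t = 0 := by
    have h1 := hδbi 2
    rw [h2b, Derivation.leibniz, Derivation.leibniz, hr2] at h1
    have h22 : δ (2 : B) = 0 := Derivation.map_natCast δ 2
    rw [h22] at h1
    simp only [smul_eq_mul, mul_zero, add_zero] at h1
    exact (mul_eq_zero.1 h1).resolve_left (mul_ne_zero h2B hr)
  have hF1Q : F 1 = aeval t Q := by
    apply hinj
    rw [hQ, hBK]
  have htnc : ∀ c, t ≠ algebraMap ℂ B c := by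
    rintro c rfl
    apply hF1nc (aeval c Q)
    rw [hF1Q, aeval_algebraMap_apply]
  have htr : ∀ R : ℂ[X], aeval t R = 0 → R = 0 := by
    intro R hR
    by_contra hne
    obtain ⟨c, hc⟩ := alg_const t R hne hR
    exact htnc c hc
  have hδQ : δ = aeval t (derivative Q) • E.θ t := by rw [hδ, hF1Q, E.θaeval]
  have hQ0 : aeval t (derivative Q) ≠ 0 := by
    intro h0; rw [h0, zero_smul] at hδQ; exact hδ0 hδQ
  have htQ : E.θ t (aeval t (derivative Q)) = 0 := by
    rw [Derivation.map_aeval, E.self, smul_zero]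
  have htln : LN (E.θ t) := LN_of_smul _ _ hQ0 htQ (by rw [← hδQ]; exact hδln)
  obtain ⟨P, hP⟩ := hcommP t (E.L_of_ln htln) hδt
  rw [hBK, ← map_mul] at hP
  have hP' := hinj hP
  have hQP : derivative Q * P = 1 := by
    have h1 : b = aeval t (derivative Q) * (b * aeval t P) := by
      rw [← hP']
      conv_lhs => rw [hb, hδQ]
      rfl
    have h2 : aeval t (derivative Q * P - 1) = 0 := by
      apply mul_left_cancel₀ hr
      simp only [map_sub, map_mul, map_one, mul_zero]
      linear_combination -h1
    exact sub_eq_zero.1 (htr _ h2)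
  obtain ⟨c, hc, hcQ⟩ := Polynomial.isUnit_iff.1 (IsUnit.of_mul_eq_one _ hQP)
  have hc0 : c ≠ 0 := hc.ne_zero
  have hδc : δ = c • E.θ t := by
    rw [hδQ, ← hcQ, aeval_C]; ext g; simp [Algebra.smul_def]
  refine ⟨c, t, hc0, ?_, ?_, htr⟩
  · intro i
    refine (hF i).congr ?_
    ext g
    apply mul_left_cancel₀ hr
    have e : bi i = i * t ^ (i - 1) * b := by
      apply hinj
      rw [hbu', ← ht]; simp
    rw [hpl, e, map_smul, E.θpow, hδc]
    simp only [Derivation.smul_apply, smul_eq_mul, Algebra.smul_def]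
    ring
  · intro g hg
    obtain ⟨P, hP⟩ := hker g (by rw [hδc, Derivation.smul_apply, hg, smul_zero])
    rw [hBK] at hP
    exact ⟨P, hinj hP⟩

end transfer
end part3

section part4
section transfer2
variable {p q : ℂ[X]} {A B : Type} [CommRing A] [Algebra ℂ A] [IsDomain A]
  [CommRing B] [Algebra ℂ B] [IsDomain B]

/-- correspondence with normalised image -/
def HS (D : DanData p A) (E : DanData q B) (φ : D.L ≃ₗ⁅ℂ⁆ E.L) (f : A) (g : B) : Prop :=
  HRel D E φ f g ∧ g ∈ E.S

variable {D : DanData p A} {E : DanData q B} {φ : D.L ≃ₗ⁅ℂ⁆ E.L}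

theorem HS.add {f g f' g'} (h : HS D E φ f g) (h' : HS D E φ f' g') :
    HS D E φ (f + f') (g + g') := ⟨h.1.add h'.1, add_mem h.2 h'.2⟩
theorem HS.sub {f g f' g'} (h : HS D E φ f g) (h' : HS D E φ f' g') :
    HS D E φ (f - f') (g - g') := ⟨h.1.sub h'.1, sub_mem h.2 h'.2⟩
theorem HS.smul {f g} (c : ℂ) (h : HS D E φ f g) : HS D E φ (c • f) (c • g) :=
  ⟨h.1.smul c, E.S.smul_mem _ h.2⟩
theorem HS.zero : HS D E φ 0 0 := ⟨HRel.zero, E.S.zero_mem⟩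
theorem HRel.brS {f g f' g'} (h : HRel D E φ f g) (h' : HRel D E φ f' g') :
    HS D E φ (D.θ f f') (E.θ g g') := ⟨h.br h', E.S_br _ _⟩
theorem HS.uniq {f g g'} (h : HS D E φ f g) (h' : HS D E φ f g') : g = g' :=
  h.1.uniqS h'.1 h.2 h'.2

/-- output of the first stage -/
structure TD (D : DanData p A) (E : DanData q B) (φ : D.L ≃ₗ⁅ℂ⁆ E.L) (c : ℂ) (t : B) : Prop where
  c0 : c ≠ 0
  hx : ∀ i : ℕ, HRel D E φ (D.x ^ i) (c • t ^ i)
  kt : ∀ g, E.θ t g = 0 → ∃ P : ℂ[X], g = aeval t P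
  tr : ∀ R : ℂ[X], aeval t R = 0 → R = 0

variable {c : ℂ} {t : B}

theorem TD.t0 (T : TD D E φ c t) : t ≠ 0 := by
  intro h
  have := T.tr X (by simpa using h)
  exact X_ne_zero this

theorem TD.lemA (T : TD D E φ c t) {k k'} (h : HRel D E φ k k') (i : ℕ) :
    HS D E φ (D.x ^ i * D.θ D.x k) (t ^ i * E.θ (c • t) k') := by
  have h1 := (T.hx (i + 1)).brS h
  have h2 := h1.smul (((i + 1 : ℕ) : ℂ)⁻¹)
  have hne : ((i + 1 : ℕ) : ℂ) ≠ 0 := Nat.cast_ne_zero.2 (Nat.succ_ne_zero i)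
  have e1 : (((i + 1 : ℕ) : ℂ)⁻¹) • D.θ (D.x ^ (i + 1)) k = D.x ^ i * D.θ D.x k := by
    rw [inv_smul_eq_iff₀ hne, D.θpow, Algebra.smul_def]
    simp; ring
  have e2 : (((i + 1 : ℕ) : ℂ)⁻¹) • E.θ (c • t ^ (i + 1)) k' = t ^ i * E.θ (c • t) k' := by
    rw [inv_smul_eq_iff₀ hne, map_smul, map_smul, E.θpow, Algebra.smul_def]
    simp; ring
  rwa [e1, e2] at h2

theorem DanData.xbr_gen (D : DanData p A) (n k : ℕ) :
    D.θ D.x (D.x ^ n * D.z ^ k) = (-(k : ℂ)) • (D.x ^ (n + 1) * D.z ^ (k - 1)) := by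
  have := D.x_br n (X ^ k)
  simp only [map_pow, aeval_X, derivative_X_pow, map_mul, aeval_C, map_natCast] at this
  rw [this, Algebra.smul_def]
  simp; ring

theorem DanData.M_prim (D : DanData p A) {f : A} (hf : f ∈ D.M) : ∃ k ∈ D.Λ, D.θ D.x k = f := by
  have : D.M ≤ D.Λ.map (D.θ D.x : A →ₗ[ℂ] A) := by
    rw [DanData.M, Submodule.span_le]
    rintro _ ⟨n, k, hn, rfl⟩
    obtain ⟨n, rfl⟩ : ∃ i, n = i + 1 := ⟨n - 1, by omega⟩
    have hne : -((k + 1 : ℕ) : ℂ) ≠ 0 := neg_ne_zero.2 (Nat.cast_ne_zero.2 (Nat.succ_ne_zero k))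
    refine ⟨(-((k + 1 : ℕ) : ℂ))⁻¹ • (D.x ^ n * D.z ^ (k + 1)),
      D.Λ.smul_mem _ (D.mem4 n (k + 1) (by omega)), ?_⟩
    change D.θ D.x _ = _
    rw [Derivation.map_smul, D.xbr_gen, smul_smul, inv_mul_cancel₀ hne, one_smul]
    simp
  obtain ⟨k, hk, h⟩ := this hf
  exact ⟨k, hk, h⟩

theorem DanData.M_br (D : DanData p A) {f g : A} (hf : f ∈ D.M) (hg : g ∈ D.M) :
    D.θ f g ∈ D.M := by
  induction hf using Submodule.span_induction with
  | zero => simp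
  | add a b _ _ ha hb => rw [map_add]; exact add_mem ha hb
  | smul r a _ ha => rw [map_smul]; exact D.M.smul_mem _ ha
  | mem a ha =>
    obtain ⟨n, k, hn, rfl⟩ := ha
    induction hg using Submodule.span_induction with
    | zero => simp
    | add a b _ _ ha hb => rw [map_add]; exact add_mem ha hb
    | smul r a _ ha => rw [Derivation.map_smul]; exact D.M.smul_mem _ ha
    | mem b hb =>
      obtain ⟨m, l, hm, rfl⟩ := hb
      have e : D.θ (D.x ^ n * D.z ^ k) (D.x ^ m * D.z ^ l) =
          (-(n * l : ℂ)) • (D.x ^ (n + m) * D.z ^ (k + (l - 1))) +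
            (k * m : ℂ) • (D.x ^ (n + m) * D.z ^ (k - 1 + l)) := by
        obtain ⟨n, rfl⟩ : ∃ i, n = i + 1 := ⟨n - 1, by omega⟩
        obtain ⟨m, rfl⟩ : ∃ i, m = i + 1 := ⟨m - 1, by omega⟩
        rw [D.θmul, D.θpow, D.θpow]
        simp only [Derivation.add_apply, Derivation.smul_apply, Derivation.leibniz,
          Derivation.leibniz_pow, D.self, D.xz, D.zx, smul_eq_mul, nsmul_eq_mul]
        simp only [Algebra.smul_def, map_mul, map_neg, map_natCast]
        simp only [Nat.add_sub_cancel]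
        ring
      rw [e]
      exact add_mem (D.M.smul_mem _ (D.M_gen _ _ (by omega)))
        (D.M.smul_mem _ (D.M_gen _ _ (by omega)))

theorem TD.hx1 (T : TD D E φ c t) : HRel D E φ D.x (c • t) := by simpa using T.hx 1

/-- hats of elements of M -/
theorem TD.hat (T : TD D E φ c t) {f} (hf : f ∈ D.M) : ∃ f', HS D E φ f f' := by
  obtain ⟨k, hk, rfl⟩ := D.M_prim hf
  obtain ⟨k', hk'⟩ := HRel.ex (φ := φ) hk
  exact ⟨_, T.hx1.brS hk'⟩

theorem TD.mulx (T : TD D E φ c t) {f f'} (hf : f ∈ D.M) (h : HS D E φ f f') (i : ℕ) :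
    HS D E φ (D.x ^ i * f) (t ^ i * f') := by
  obtain ⟨k, hk, rfl⟩ := D.M_prim hf
  obtain ⟨k', hk'⟩ := HRel.ex (φ := φ) hk
  have e := h.uniq (T.hx1.brS hk')
  rw [e]
  exact T.lemA hk' i

theorem TD.mulx1 (T : TD D E φ c t) {f f'} (hf : f ∈ D.M) (h : HS D E φ f f') :
    HS D E φ (D.x * f) (t * f') := by
  simpa using T.mulx hf h 1

theorem TD.mul (T : TD D E φ c t) {f f' k k'} (hf : f ∈ D.M) (h : HS D E φ f f')
    (hk : k ∈ D.M) (h' : HS D E φ k k') :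
    HS D E φ (f * D.θ D.x k) (f' * E.θ t k') := by
  have h1 := (T.mulx1 hf h).1.brS h'.1
  have h2 := T.mulx1 (D.M_br hf hk) (h.1.brS h'.1)
  have h3 := h1.sub h2
  have e1 : D.θ (D.x * f) k - D.x * D.θ f k = f * D.θ D.x k := by
    rw [D.θmul]; simp
  have e2 : E.θ (t * f') k' - t * E.θ f' k' = f' * E.θ t k' := by
    rw [E.θmul]; simp
  rwa [e1, e2] at h3

/-- the pure power is normalised -/
theorem TD.xS (T : TD D E φ c t) (n : ℕ) (hn : D.N + 1 ≤ n) :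
    HS D E φ (D.x ^ n) (c • t ^ n) := by
  have hm : D.x ^ n ∈ D.M := by simpa using D.M_gen n 0 hn
  obtain ⟨g, hg⟩ := T.hat hm
  have h1 : ∃ κ, g = c • t ^ n + algebraMap ℂ B κ := by
    obtain ⟨κ, hκ⟩ := E.ker (g - c • t ^ n) (by
      rw [map_sub, hg.1.uniq (T.hx n), sub_self])
    exact ⟨κ, by rw [← hκ]; ring⟩
  obtain ⟨κ, hκ⟩ := h1
  have h2 := T.mulx1 hm hg
  rw [← pow_succ'] at h2
  have h3 : ∃ κ', t * g = c • t ^ (n + 1) + algebraMap ℂ B κ' := by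
    obtain ⟨κ, hκ⟩ := E.ker (t * g - c • t ^ (n + 1)) (by
      rw [map_sub, h2.1.uniq (T.hx (n + 1)), sub_self])
    exact ⟨κ, by rw [← hκ]; ring⟩
  obtain ⟨κ', hκ'⟩ := h3
  have h4 : C κ * X - C κ' = 0 := by
    apply T.tr
    rw [hκ, Algebra.smul_def, Algebra.smul_def] at hκ'
    simp only [map_sub, map_mul, aeval_C, aeval_X]
    linear_combination hκ'
  have h5 : κ = 0 := by
    have := congrArg (fun P : ℂ[X] => P.coeff 1) h4
    simpa [coeff_C] using this
  rw [h5, map_zero, add_zero] at hκ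
  rw [← hκ]; exact hg

theorem TD.cancelC (T : TD D E φ c t) {g : B} (h : E.θ (c • t) g = 0) : E.θ t g = 0 := by
  rw [map_smul, Derivation.smul_apply] at h
  exact (smul_eq_zero.1 h).resolve_left T.c0

theorem TD.key (T : TD D E φ c t) {f f'} (h : HRel D E φ f f') :
    ∃ m0, ∀ m, m0 ≤ m → ∃ κ : ℂ, HS D E φ (D.x ^ m * f) (t ^ m * (f' - algebraMap ℂ B κ)) := by
  obtain ⟨m0, hm0⟩ := D.M_big f
  refine ⟨m0 + 1, fun m hm => ?_⟩
  obtain ⟨m, rfl⟩ : ∃ i, m = i + 1 := ⟨m - 1, by omega⟩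
  have hFM := hm0 (m + 1) (by omega)
  set F := D.x ^ (m + 1) * f with hF
  obtain ⟨F', hF'⟩ := T.hat hFM
  have hxF : D.θ D.x F = D.x ^ (m + 1) * D.θ D.x f := by
    rw [hF, Derivation.leibniz, Derivation.leibniz_pow, D.self]; simp
  have htF : E.θ (c • t) F' = t ^ (m + 1) * E.θ (c • t) f' := by
    have h1 := T.hx1.brS hF'.1
    rw [hxF] at h1
    exact h1.uniq (T.lemA h (m + 1))
  have htF' : E.θ t F' = t ^ (m + 1) * E.θ t f' := by
    have h1 := htF
    simp only [map_smul, Derivation.smul_apply, mul_smul_comm] at h1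
    exact smul_right_injective B T.c0 h1
  set e := t ^ (m + 1) * f' - F' with he
  have hte : E.θ t e = 0 := by
    rw [he, map_sub, htF', Derivation.leibniz, Derivation.leibniz_pow, E.self]
    simp
  obtain ⟨R, hR⟩ := T.kt e hte
  -- the Euler type element
  set n := D.N + 1 with hn
  set g0 := D.x ^ n * D.z ^ 1 with hg0
  have hg0M : g0 ∈ D.M := D.M_gen n 1 le_rfl
  obtain ⟨γ0, hγ0⟩ := T.hat hg0M
  set g := D.x * g0 with hg
  set γ := t * γ0 with hγ
  have hgM : g ∈ D.M := by
    have := D.M_gen (n + 1) 1 (by omega)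
    rw [hg, hg0]
    convert this using 1
    ring
  have hγS : HS D E φ g γ := T.mulx1 hg0M hγ0
  have hgx : D.θ g D.x = D.x ^ (n + 2) := by
    rw [hg, hg0, pow_one, D.θmul, D.θmul, D.θpow]
    simp [D.zx, D.self]; ring
  have hγt : E.θ γ t = t ^ (n + 2) := by
    have h1 := hγS.1.brS T.hx1
    rw [hgx] at h1
    have h2 := h1.uniq (T.xS (n + 2) (by omega))
    rw [Derivation.map_smul] at h2
    exact smul_right_injective B T.c0 h2
  -- hat of x^(m+1) {g,f}
  have s1 : HS D E φ (D.x ^ (m + 1) * D.θ g f) (t ^ (m + 1) * E.θ γ f') := by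
    have a1 := (T.mulx hgM hγS (m + 1)).1.brS h
    have a2 := (T.mul hg0M hγ0 hFM hF').smul ((m + 1 : ℕ) : ℂ)
    have a3 := a1.sub a2
    have e1 : D.θ (D.x ^ (m + 1) * g) f - ((m + 1 : ℕ) : ℂ) • (g0 * D.θ D.x F) =
        D.x ^ (m + 1) * D.θ g f := by
      rw [hxF, D.θmul, D.θpow, hg, Algebra.smul_def]
      simp only [Derivation.add_apply, Derivation.smul_apply, smul_eq_mul, map_natCast,
        Nat.add_sub_cancel]
      ring
    have e2 : E.θ (t ^ (m + 1) * γ) f' - ((m + 1 : ℕ) : ℂ) • (γ0 * E.θ t F') =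
        t ^ (m + 1) * E.θ γ f' := by
      rw [htF', E.θmul, E.θpow, hγ, Algebra.smul_def]
      simp only [Derivation.add_apply, Derivation.smul_apply, smul_eq_mul, map_natCast,
        Nat.add_sub_cancel]
      ring
    rwa [e1, e2] at a3
  have s2 := ((T.mulx hFM hF' (n + 1)).smul ((m + 1 : ℕ) : ℂ)).add s1
  have e3 : ((m + 1 : ℕ) : ℂ) • (D.x ^ (n + 1) * F) + D.x ^ (m + 1) * D.θ g f = D.θ g F := by
    rw [hF, Derivation.leibniz, Derivation.leibniz_pow, hgx, Algebra.smul_def]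
    simp only [smul_eq_mul, nsmul_eq_mul, map_natCast, Nat.add_sub_cancel]
    ring
  rw [e3] at s2
  have e4 := s2.uniq (hγS.1.brS hF'.1)
  have e5 : E.θ γ e = ((m + 1 : ℕ) : B) * t ^ (n + 1) * e := by
    rw [he, map_sub, ← e4, Derivation.leibniz, Derivation.leibniz_pow, hγt]
    simp only [smul_eq_mul, nsmul_eq_mul]
    simp only [Algebra.smul_def, map_natCast, Nat.add_sub_cancel]
    ring
  have e6 : X * derivative R - C ((m + 1 : ℕ) : ℂ) * R = 0 := by
    apply T.tr
    rw [hR, Derivation.map_aeval, hγt, smul_eq_mul] at e5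
    apply mul_left_cancel₀ (pow_ne_zero (n + 1) T.t0)
    simp only [map_sub, map_mul, aeval_X, aeval_C, map_natCast, mul_zero]
    linear_combination e5
  have e7 : R = C (R.coeff (m + 1)) * X ^ (m + 1) := by
    ext i
    rw [coeff_C_mul_X_pow]
    split_ifs with hi
    · rw [hi]
    · have h8 := congrArg (fun P : ℂ[X] => P.coeff i) e6
      simp only [coeff_sub, coeff_C_mul, coeff_zero] at h8
      rcases i with _ | i
      · rw [coeff_X_mul_zero] at h8
        have : ((m + 1 : ℕ) : ℂ) ≠ 0 := Nat.cast_ne_zero.2 (Nat.succ_ne_zero m)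
        rw [zero_sub, neg_eq_zero] at h8
        exact (mul_eq_zero.1 h8).resolve_left this
      · rw [coeff_X_mul, coeff_derivative] at h8
        have h9 : ((i : ℂ) - m) * R.coeff (i + 1) = 0 := by
          push_cast at h8; linear_combination h8
        refine (mul_eq_zero.1 h9).resolve_left ?_
        intro hh
        rw [sub_eq_zero] at hh
        apply hi
        have : i = m := by exact_mod_cast hh
        rw [this]
  refine ⟨R.coeff (m + 1), ?_⟩
  have e8 : F' = t ^ (m + 1) * (f' - algebraMap ℂ B (R.coeff (m + 1))) := by
    have h1 := hR
    rw [e7] at h1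
    simp only [map_mul, aeval_C, map_pow, aeval_X] at h1
    rw [he] at h1
    linear_combination -h1
  rw [← e8]; exact hF'

set_option maxHeartbeats 2000000 in
theorem stage3b [IsIntegrallyClosed A] [IsIntegrallyClosed B] (T : TD D E φ c t) :
    Nonempty (A ≃ₐ[ℂ] B) := by
  set n := D.N + 2 with hn
  choose G hG using fun k : ℕ => T.hat (D.M_gen n k (by omega))
  have hG0 : G 0 = c • t ^ n := by
    apply (hG 0).uniq
    simpa using T.xS n (by omega)
  -- multiplicativity
  have hmul : ∀ k, c • t ^ n * G (k + 1) = G k * G 1 := by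
    intro k
    set w := (-((1 + 1 : ℕ) : ℂ))⁻¹ • (D.x ^ (D.N + 1) * D.z ^ (1 + 1)) with hw
    have hne : -((1 + 1 : ℕ) : ℂ) ≠ 0 := by norm_num
    have hwM : w ∈ D.M := D.M.smul_mem _ (D.M_gen _ _ le_rfl)
    have hwx : D.θ D.x w = D.x ^ n * D.z ^ 1 := by
      rw [hw, Derivation.map_smul, D.xbr_gen, smul_smul, inv_mul_cancel₀ hne, one_smul]
    obtain ⟨w', hw'⟩ := T.hat hwM
    have h1 := T.mul (D.M_gen n k (by omega)) (hG k) hwM hw'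
    have h2 := T.hx1.brS hw'.1
    rw [hwx] at h1 h2
    have h3 := h2.uniq (hG 1)
    rw [map_smul, Derivation.smul_apply] at h3
    have h4 := T.mulx (D.M_gen n (k + 1) (by omega)) (hG (k + 1)) n
    have e : D.x ^ n * (D.x ^ n * D.z ^ (k + 1)) = D.x ^ n * D.z ^ k * (D.x ^ n * D.z ^ 1) := by
      ring
    rw [e] at h4
    have h5 := h4.uniq h1
    rw [← h3, mul_smul_comm, ← h5, smul_mul_assoc]
  let K := FractionRing B
  have hinj : Function.Injective (algebraMap B K) := IsFractionRing.injective B K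
  set τ := c • t ^ n with hτ
  have hτ0 : τ ≠ 0 := smul_ne_zero T.c0 (pow_ne_zero _ T.t0)
  have hτK : algebraMap B K τ ≠ 0 := by
    intro h; exact hτ0 (hinj (by rw [h, map_zero]))
  set u : K := algebraMap B K (G 1) / algebraMap B K τ with hu
  have hu1 : algebraMap B K (G 1) = algebraMap B K τ * u := by
    rw [hu, mul_div_cancel₀ _ hτK]
  have hGu : ∀ k, algebraMap B K (G k) = algebraMap B K τ * u ^ k := by
    intro k
    induction k with
    | zero => rw [hG0]; simp
    | succ k ih =>
      have := congrArg (algebraMap B K) (hmul k)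
      rw [map_mul, map_mul, ih, hu1] at this
      apply mul_left_cancel₀ hτK
      rw [this]; ring
  -- polynomials in z
  have hpoly : ∀ P : ℂ[X], ∃ e, HS D E φ (D.x ^ n * aeval D.z P) e ∧
      algebraMap B K e = algebraMap B K τ * aeval u P := by
    intro P
    induction P using Polynomial.induction_on' with
    | add P Q hP hQ =>
      obtain ⟨e, he, he'⟩ := hP
      obtain ⟨f, hf, hf'⟩ := hQ
      refine ⟨e + f, by rw [map_add, mul_add]; exact he.add hf, ?_⟩
      simp only [map_add, he', hf']
      ring
    | monomial k a =>
      refine ⟨a • G k, ?_, ?_⟩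
      · rw [aeval_monomial, ← Algebra.smul_def, mul_smul_comm]
        exact (hG k).smul a
      · rw [aeval_monomial, Algebra.smul_def, map_mul, hGu, ← IsScalarTower.algebraMap_apply]
        ring
  -- the element y
  obtain ⟨y', hy'⟩ := HRel.ex (φ := φ) D.y_Λ
  obtain ⟨m0, hm0⟩ := T.key hy'
  obtain ⟨κ, hκ⟩ := hm0 (m0 + n + 1) (by omega)
  obtain ⟨e, he, heK⟩ := hpoly p
  have he2 := T.mulx (D.M_poly n p (by omega)) he m0
  have e1 : D.x ^ (m0 + n + 1) * D.y = D.x ^ m0 * (D.x ^ n * aeval D.z p) := by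
    rw [← D.xy]; ring
  rw [e1] at hκ
  have e2 := he2.uniq hκ
  set s := c⁻¹ • (y' - algebraMap ℂ B κ) with hs
  have hys : y' - algebraMap ℂ B κ = c • s := by rw [hs, smul_inv_smul₀ T.c0]
  have hpu : aeval u p = algebraMap B K (t * s) := by
    have e3 : e = τ * (t * s) := by
      apply mul_left_cancel₀ (pow_ne_zero m0 T.t0)
      rw [e2, hys, hτ, Algebra.smul_def, Algebra.smul_def]
      ring
    apply mul_left_cancel₀ hτK
    rw [← heK, e3, map_mul]
  obtain ⟨Z, hZ⟩ := intlem (IsScalarTower.toAlgHom ℂ B K) hinj u (G 1) τ (t * s) hτ0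
    hu1.symm p (by have := D.deg; omega) hpu
  replace hZ : algebraMap B K Z = u := hZ
  have hpZ : t * s = aeval Z p := by
    apply hinj
    rw [← hpu, ← hZ, aeval_algebraMap_apply]
  have hGZ : ∀ k, G k = τ * Z ^ k := by
    intro k; apply hinj; rw [hGu, map_mul, map_pow, hZ]
  obtain ⟨ψ, hψx, hψy, hψz⟩ := D.univ B t s Z hpZ
  have hMψ : ∀ f ∈ D.M, HS D E φ f (c • ψ f) := by
    intro f hf
    induction hf using Submodule.span_induction with
    | zero => rw [map_zero, smul_zero]; exact HS.zero
    | add a b _ _ ha hb => rw [map_add, smul_add]; exact ha.add hb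
    | smul r a _ ha => rw [map_smul, smul_comm]; exact ha.smul r
    | mem a ha =>
      obtain ⟨i, k, hi, rfl⟩ := ha
      obtain ⟨g, hg⟩ := T.hat (D.M_gen i k hi)
      have h1 := T.mulx (D.M_gen i k hi) hg n
      have h2 := T.mulx (D.M_gen n k (by omega)) (hG k) i
      have e : D.x ^ n * (D.x ^ i * D.z ^ k) = D.x ^ i * (D.x ^ n * D.z ^ k) := by ring
      rw [e] at h1
      have h3 := h1.uniq h2
      have : g = c • ψ (D.x ^ i * D.z ^ k) := by
        apply mul_left_cancel₀ (pow_ne_zero n T.t0)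
        rw [h3, hGZ, map_mul, map_pow, map_pow, hψx, hψz, hτ, Algebra.smul_def, Algebra.smul_def]
        ring
      rw [← this]; exact hg
  have hΛψ : ∀ f f', HRel D E φ f f' → ∃ a : ℂ, f' = c • ψ f + algebraMap ℂ B a := by
    intro f f' h
    obtain ⟨m1, hm1⟩ := T.key h
    obtain ⟨m2, hm2⟩ := D.M_big f
    obtain ⟨a, ha⟩ := hm1 (m1 + m2) (by omega)
    have h1 := ha.uniq (hMψ _ (hm2 (m1 + m2) (by omega)))
    refine ⟨a, ?_⟩
    rw [map_mul, map_pow, hψx, ← mul_smul_comm] at h1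
    have h2 := mul_left_cancel₀ (pow_ne_zero _ T.t0) h1
    rw [← h2]; ring
  have hψi : Function.Injective ψ := by
    rw [injective_iff_map_eq_zero]
    intro f hf
    obtain ⟨m, hm⟩ := D.M_big f
    have hcst : ∀ i, m ≤ i → ∃ a, D.x ^ i * f = algebraMap ℂ A a := by
      intro i hi
      have h1 := hMψ _ (hm i hi)
      rw [map_mul, hf, mul_zero, smul_zero] at h1
      exact D.ker _ (h1.1.left_zero (by simp))
    obtain ⟨a, ha⟩ := hcst m le_rfl
    obtain ⟨b, hb⟩ := hcst (m + 1) (by omega)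
    have h1 : D.x * algebraMap ℂ A a = algebraMap ℂ A b := by rw [← ha, ← hb]; ring
    have h2 := congrArg (D.θ D.z) h1
    rw [Derivation.leibniz, D.zx, Derivation.map_algebraMap, Derivation.map_algebraMap, ← ha] at h2
    simp only [smul_eq_mul, mul_zero, zero_add] at h2
    have h3 := (mul_eq_zero.1 h2).resolve_right D.x0
    exact (mul_eq_zero.1 h3).resolve_left (pow_ne_zero _ D.x0)
  have hΛr : ∀ g ∈ E.Λ, ∃ f, ψ f = g := by
    intro g hg
    obtain ⟨f, hf⟩ := HRel.surj (φ := φ) hg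
    obtain ⟨a, ha⟩ := hΛψ f g hf
    exact ⟨c • f + algebraMap ℂ A a, by rw [map_add, map_smul, AlgHom.commutes, ha]⟩
  have hψs : Function.Surjective ψ := by
    obtain ⟨x1, hx1⟩ := hΛr _ E.x_Λ
    obtain ⟨y1, hy1⟩ := hΛr _ E.y_Λ
    obtain ⟨a, ha⟩ := hΛr _ (E.xn_Λ E.N)
    obtain ⟨b, hb⟩ := hΛr _ (E.mem4 E.N 1 le_rfl)
    obtain ⟨z1, hz1⟩ := intlem ψ hψi E.z b a (x1 * y1)
      (by
        rintro rfl
        rw [map_zero] at ha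
        exact pow_ne_zero _ E.x0 ha.symm)
      (by rw [ha, hb, pow_one]) q (by have := E.deg; omega)
      (by rw [map_mul, hx1, hy1, E.xy])
    have : (⊤ : Subalgebra ℂ B) ≤ ψ.range := by
      rw [← E.gen]
      apply Algebra.adjoin_le
      rintro f (rfl | rfl | rfl)
      · exact ⟨x1, hx1⟩
      · exact ⟨y1, hy1⟩
      · exact ⟨z1, hz1⟩
    intro g
    exact this (Algebra.mem_top (x := g))
  exact ⟨AlgEquiv.ofBijective ψ ⟨hψi, hψs⟩⟩

theorem stage3 [IsIntegrallyClosed A] [IsIntegrallyClosed B] (D : DanData p A) (E : DanData q B)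
    (φ : D.L ≃ₗ⁅ℂ⁆ E.L) : Nonempty (A ≃ₐ[ℂ] B) := by
  obtain ⟨c, t, h1, h2, h3, h4⟩ := stage3a D E φ
  exact stage3b (⟨h1, h2, h3, h4⟩ : TD D E φ c t)

end transfer2
end part4

section part5
/-- Laurent polynomials in `x` over `ℂ[z]`. -/
abbrev LZ : Type := LaurentPolynomial ℂ[X]

abbrev lC : ℂ[X] →+* LZ := LaurentPolynomial.C
abbrev lT (n : ℤ) : LZ := LaurentPolynomial.T n

theorem lT_add (n m : ℤ) : lT (n + m) = lT n * lT m := LaurentPolynomial.T_add n m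
theorem lT_zero : lT 0 = 1 := LaurentPolynomial.T_zero
theorem lT_pow (m : ℤ) (n : ℕ) : lT m ^ n = lT (n * m) := LaurentPolynomial.T_pow m n
theorem la_coeff (f g : LZ) (n : ℤ) : (f + g).coeff n = f.coeff n + g.coeff n := by
  rw [AddMonoidAlgebra.coeff_add, Finsupp.add_apply]
theorem ls_coeff (f g : LZ) (n : ℤ) : (f - g).coeff n = f.coeff n - g.coeff n := by
  rw [AddMonoidAlgebra.coeff_sub, Finsupp.sub_apply]

theorem lmon_coeff (f : ℂ[X]) (n m : ℤ) : (lC f * lT n).coeff m = if n = m then f else 0 := by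
  rw [← LaurentPolynomial.single_eq_C_mul_T, AddMonoidAlgebra.coeff_single, Finsupp.single_apply]

theorem lt_sum (f : LZ) : f = ∑ n ∈ f.coeff.support, lC (f.coeff n) * lT n := by
  conv_lhs => rw [← AddMonoidAlgebra.sum_coeff_single f]
  rw [Finsupp.sum]
  refine Finset.sum_congr rfl fun n _ => ?_
  rw [LaurentPolynomial.single_eq_C_mul_T]

def mkLT (f : LZ) (F : ℤ → ℂ[X]) (h : ∀ n, f.coeff n = 0 → F n = 0) : LZ :=
  AddMonoidAlgebra.ofCoeff (Finsupp.onFinset f.coeff.support F (fun n hn => by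
    rw [Finsupp.mem_support_iff]; exact fun h0 => hn (h n h0)))

theorem mkLT_coeff (f : LZ) (F : ℤ → ℂ[X]) (h) (n : ℤ) : (mkLT f F h).coeff n = F n := rfl

def lEl : LZ →ₗ[ℂ] LZ where
  toFun f := mkLT f (fun n => (n : ℂ[X]) * f.coeff n) (fun n h => by rw [h, mul_zero])
  map_add' f g := by
    apply LaurentPolynomial.ext; intro n
    rw [la_coeff (mkLT f _ _), mkLT_coeff, mkLT_coeff, mkLT_coeff, la_coeff, mul_add]
  map_smul' c f := by
    apply LaurentPolynomial.ext; intro n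
    simp only [RingHom.id_apply, AddMonoidAlgebra.coeff_smul, Finsupp.smul_apply, mkLT_coeff]
    rw [mul_smul_comm]

def lDl : LZ →ₗ[ℂ] LZ where
  toFun f := mkLT f (fun n => derivative (f.coeff n)) (fun n h => by rw [h, map_zero])
  map_add' f g := by
    apply LaurentPolynomial.ext; intro n
    rw [la_coeff (mkLT f _ _), mkLT_coeff, mkLT_coeff, mkLT_coeff, la_coeff, map_add]
  map_smul' c f := by
    apply LaurentPolynomial.ext; intro n
    simp only [RingHom.id_apply, AddMonoidAlgebra.coeff_smul, Finsupp.smul_apply, mkLT_coeff]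
    rw [derivative_smul]

theorem lEl_coeff (f : LZ) (n : ℤ) : (lEl f).coeff n = (n : ℂ[X]) * f.coeff n := rfl
theorem lDl_coeff (f : LZ) (n : ℤ) : (lDl f).coeff n = derivative (f.coeff n) := rfl

theorem lEl_mon (f : ℂ[X]) (n : ℤ) : lEl (lC f * lT n) = (n : LZ) * (lC f * lT n) := by
  apply LaurentPolynomial.ext; intro m
  have : (n : LZ) = lC (n : ℂ[X]) := by simp
  rw [lEl_coeff, this, ← mul_assoc, ← map_mul, lmon_coeff, lmon_coeff]
  split_ifs with h
  · rw [h]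
  · simp

theorem lDl_mon (f : ℂ[X]) (n : ℤ) : lDl (lC f * lT n) = lC (derivative f) * lT n := by
  apply LaurentPolynomial.ext; intro m
  rw [lDl_coeff, lmon_coeff, lmon_coeff]
  split_ifs with h
  · rfl
  · simp

theorem lmon_mul (f g : ℂ[X]) (n m : ℤ) :
    (lC f * lT n) * (lC g * lT m) = lC (f * g) * lT (n + m) := by
  rw [lT_add, map_mul]; ring

theorem leib_of_mon (L : LZ →ₗ[ℂ] LZ)
    (h : ∀ f g n m, L ((lC f * lT n) * (lC g * lT m)) =
      (lC f * lT n) * L (lC g * lT m) + (lC g * lT m) * L (lC f * lT n)) (a b : LZ) :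
    L (a * b) = a • L b + b • L a := by
  simp only [smul_eq_mul]
  induction a using LaurentPolynomial.induction_on' with
  | add a a' ha ha' => rw [add_mul, map_add, ha, ha', map_add]; ring
  | C_mul_T n f =>
    induction b using LaurentPolynomial.induction_on' with
    | add a a' ha ha' => rw [mul_add, map_add, ha, ha', map_add]; ring
    | C_mul_T m g => exact h f g n m

def lE : Derivation ℂ LZ LZ := Derivation.mk' lEl (leib_of_mon lEl (by
  intro f g n m
  rw [lmon_mul, lEl_mon, lEl_mon, lEl_mon, ← lmon_mul]
  push_cast; ring))

def lD : Derivation ℂ LZ LZ := Derivation.mk' lDl (leib_of_mon lDl (by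
  intro f g n m
  rw [lmon_mul, lDl_mon, lDl_mon, lDl_mon, lmon_mul, lmon_mul, derivative_mul, map_add, add_mul,
    add_comm m n, mul_comm g, add_comm]))

theorem lE_coeff (f : LZ) (n : ℤ) : (lE f).coeff n = (n : ℂ[X]) * f.coeff n := rfl
theorem lD_coeff (f : LZ) (n : ℤ) : (lD f).coeff n = derivative (f.coeff n) := rfl
theorem lE_mon (f : ℂ[X]) (n : ℤ) : lE (lC f * lT n) = (n : LZ) * (lC f * lT n) := lEl_mon f n
theorem lD_mon (f : ℂ[X]) (n : ℤ) : lD (lC f * lT n) = lC (derivative f) * lT n := lDl_mon f n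
theorem lE_C (f : ℂ[X]) : lE (lC f) = 0 := by
  have := lE_mon f 0
  simpa using this
theorem lD_C (f : ℂ[X]) : lD (lC f) = lC (derivative f) := by
  have := lD_mon f 0
  simpa using this
theorem lE_T (n : ℤ) : lE (lT n) = (n : LZ) * lT n := by
  have := lE_mon 1 n
  simpa using this
theorem lD_T (n : ℤ) : lD (lT n) = 0 := by
  have := lD_mon 1 n
  simpa using this
theorem lED (f : LZ) : lE (lD f) = lD (lE f) := by
  apply LaurentPolynomial.ext; intro m
  rw [lE_coeff, lD_coeff, lD_coeff, lE_coeff, derivative_mul]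
  simp

/-- the Poisson bracket on Laurent polynomials -/
def lbr (f g : LZ) : LZ := lD f * lE g - lE f * lD g

theorem lbr_zx : lbr (lC X) (lT 1) = lT 1 := by
  simp [lbr, lD_C, lE_T, lE_C]

theorem lbr_jac (f g h : LZ) : lbr (lbr f g) h = lbr f (lbr g h) - lbr g (lbr f h) := by
  simp only [lbr, map_sub, Derivation.leibniz, smul_eq_mul, lED]
  ring

/-- the subring which is the image of the coordinate ring -/
def Rg (p : ℂ[X]) : Subalgebra ℂ LZ where
  carrier := {f | ∀ i : ℤ, p ^ ((-i).toNat) ∣ f.coeff i}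
  mul_mem' := by
    intro a b ha hb i
    rw [lt_sum a, lt_sum b, Finset.sum_mul_sum, AddMonoidAlgebra.coeff_sum, Finsupp.finset_sum_apply]
    refine Finset.dvd_sum fun n _ => ?_
    rw [AddMonoidAlgebra.coeff_sum, Finsupp.finset_sum_apply]
    refine Finset.dvd_sum fun m _ => ?_
    rw [lmon_mul, lmon_coeff]
    split_ifs with h
    · refine dvd_trans ?_ (mul_dvd_mul (ha n) (hb m))
      rw [← pow_add]
      exact pow_dvd_pow _ (by omega)
    · exact dvd_zero _
  add_mem' := by
    intro a b ha hb i
    rw [AddMonoidAlgebra.coeff_add, Finsupp.add_apply]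
    exact dvd_add (ha i) (hb i)
  algebraMap_mem' := by
    intro c i
    have : algebraMap ℂ LZ c = lC (C c) * lT 0 := by
      simp [LaurentPolynomial.algebraMap_apply]
    rw [this, lmon_coeff]
    split_ifs with h
    · subst h; simp
    · exact dvd_zero _

theorem mem_Rg {p : ℂ[X]} {f : LZ} : f ∈ Rg p ↔ ∀ i : ℤ, p ^ ((-i).toNat) ∣ f.coeff i := Iff.rfl
end part5

section ring
variable (p : ℂ[X])

def dx : ODan p := Ideal.Quotient.mk _ xP
def dy : ODan p := Ideal.Quotient.mk _ yP
def dz : ODan p := Ideal.Quotient.mk _ zP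

theorem mk_aeval (f : ℂ[X]) (r : P3) :
    (Ideal.Quotient.mk (relIdeal p) (aeval r f) : ODan p) = aeval (Ideal.Quotient.mk (relIdeal p) r) f := by
  have := Polynomial.aeval_algHom_apply (Ideal.Quotient.mkₐ ℂ (relIdeal p)) r f
  exact this.symm

theorem dxy : dx p * dy p = aeval (dz p) p := by
  rw [dx, dy, dz, ← mk_aeval, ← map_mul, Ideal.Quotient.eq]
  exact Ideal.subset_span rfl

theorem dlift (B : Type) [CommRing B] [Algebra ℂ B] (t s Z : B) (h : t * s = aeval Z p) :
    ∃ ψ : ODan p →ₐ[ℂ] B, ψ (dx p) = t ∧ ψ (dy p) = s ∧ ψ (dz p) = Z := by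
  let φ : P3 →ₐ[ℂ] B := MvPolynomial.aeval ![t, s, Z]
  have hx : φ xP = t := by simp [φ, xP]
  have hy : φ yP = s := by simp [φ, yP]
  have hz : φ zP = Z := by simp [φ, zP]
  have h0 : ∀ a ∈ relIdeal p, φ a = 0 := by
    intro a ha
    have : relIdeal p ≤ RingHom.ker φ.toRingHom := by
      rw [relIdeal, Ideal.span_le]
      rintro _ rfl
      change φ _ = 0
      rw [map_sub, map_mul, ← Polynomial.aeval_algHom_apply, hx, hy, hz, h, sub_self]
    exact this ha
  refine ⟨Ideal.Quotient.liftₐ (relIdeal p) φ h0, ?_, ?_, ?_⟩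
  · exact hx
  · exact hy
  · exact hz

theorem dgen : Algebra.adjoin ℂ {dx p, dy p, dz p} = ⊤ := by
  rw [eq_top_iff]
  intro a _
  obtain ⟨a, rfl⟩ := Ideal.Quotient.mk_surjective a
  induction a using MvPolynomial.induction_on with
  | C c =>
    exact Subalgebra.algebraMap_mem _ c
  | add a b ha hb => rw [map_add]; exact add_mem (ha trivial) (hb trivial)
  | mul_X a i ha =>
    rw [map_mul]
    refine mul_mem (ha trivial) (Algebra.subset_adjoin ?_)
    fin_cases i
    · exact Or.inl rfl
    · exact Or.inr (Or.inl rfl)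
    · exact Or.inr (Or.inr rfl)

theorem iota_ex : ∃ ψ : ODan p →ₐ[ℂ] LZ, ψ (dx p) = lT 1 ∧ ψ (dy p) = lC p * lT (-1) ∧
    ψ (dz p) = lC X := by
  apply dlift
  have h : ∀ f : ℂ[X], aeval (lC X) f = lC f := by
    intro f
    have := Polynomial.aeval_algHom_apply (R := ℂ) (⟨lC, fun c => by
      simp [LaurentPolynomial.algebraMap_apply]⟩ : ℂ[X] →ₐ[ℂ] LZ) X f
    rw [aeval_X_left_apply] at this
    exact this
  rw [h, mul_left_comm, ← lT_add]
  simp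

def iota : ODan p →ₐ[ℂ] LZ := (iota_ex p).choose
theorem iota_x : iota p (dx p) = lT 1 := (iota_ex p).choose_spec.1
theorem iota_y : iota p (dy p) = lC p * lT (-1) := (iota_ex p).choose_spec.2.1
theorem iota_z : iota p (dz p) = lC X := (iota_ex p).choose_spec.2.2

theorem aeval_lC (f : ℂ[X]) : aeval (lC X) f = lC f := by
  have := Polynomial.aeval_algHom_apply (R := ℂ) (⟨lC, fun c => by
    simp [LaurentPolynomial.algebraMap_apply]⟩ : ℂ[X] →ₐ[ℂ] LZ) X f
  rw [aeval_X_left_apply] at this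
  exact this

theorem iota_az (f : ℂ[X]) : iota p (aeval (dz p) f) = lC f := by
  rw [← Polynomial.aeval_algHom_apply, iota_z, aeval_lC]

/-- standard monomials -/
def wm (n : ℤ) (c : ℂ[X]) : ODan p := aeval (dz p) c * (dx p ^ n.toNat * dy p ^ (-n).toNat)

theorem iota_wm (n : ℤ) (c : ℂ[X]) : iota p (wm p n c) = lC (c * p ^ (-n).toNat) * lT n := by
  rw [wm, map_mul, map_mul, map_pow, map_pow, iota_az, iota_x, iota_y, mul_pow, lT_pow, lT_pow,
    map_mul, map_pow]
  have : lT n = lT (n.toNat * 1) * lT ((-n).toNat * (-1)) := by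
    rw [← lT_add]; congr 1; omega
  rw [this]; ring

def Wm : LZ →+ ODan p where
  toFun F := Finsupp.liftAddHom (fun n : ℤ => (⟨⟨wm p n, by simp [wm]⟩, by
    intro a b; simp [wm, add_mul]⟩ : ℂ[X] →+ ODan p)) F.coeff
  map_zero' := by rw [AddMonoidAlgebra.coeff_zero, map_zero]
  map_add' F G := by rw [AddMonoidAlgebra.coeff_add, map_add]

theorem Wm_mon (n : ℤ) (c : ℂ[X]) : Wm p (lC c * lT n) = wm p n c := by
  rw [← LaurentPolynomial.single_eq_C_mul_T]
  change Finsupp.liftAddHom (fun n : ℤ => (⟨⟨wm p n, by simp [wm]⟩, by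
    intro a b; simp [wm, add_mul]⟩ : ℂ[X] →+ ODan p)) (AddMonoidAlgebra.single n c : LZ).coeff = _
  rw [AddMonoidAlgebra.coeff_single, Finsupp.liftAddHom_apply_single]
  rfl

theorem wm_x (n : ℤ) (c : ℂ[X]) : ∃ c', wm p n c * dx p = wm p (n + 1) c' := by
  rcases le_or_gt 0 n with h | h
  · refine ⟨c, ?_⟩
    obtain ⟨k, rfl⟩ := Int.eq_ofNat_of_zero_le h
    rw [wm, wm, show (-((k : ℤ) + 1)).toNat = 0 by omega, show (-(k : ℤ)).toNat = 0 by omega,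
      show ((k : ℤ) + 1).toNat = k + 1 by omega, show (k : ℤ).toNat = k by omega]
    ring
  · refine ⟨c * p, ?_⟩
    obtain ⟨k, hk⟩ : ∃ k : ℕ, n = -(k + 1 : ℤ) := ⟨(-n - 1).toNat, by omega⟩
    rw [wm, wm, show (-(n + 1)).toNat = k by omega, show (-n).toNat = k + 1 by omega,
      show n.toNat = 0 by omega, show (n + 1).toNat = 0 by omega, map_mul, ← dxy]
    ring

theorem wm_y (n : ℤ) (c : ℂ[X]) : ∃ c', wm p n c * dy p = wm p (n - 1) c' := by
  rcases le_or_gt n 0 with h | h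
  · refine ⟨c, ?_⟩
    obtain ⟨k, hk⟩ : ∃ k : ℕ, n = -(k : ℤ) := ⟨(-n).toNat, by omega⟩
    rw [wm, wm, show (-(n - 1)).toNat = k + 1 by omega, show (-n).toNat = k by omega,
      show (n - 1).toNat = 0 by omega, show n.toNat = 0 by omega]
    ring
  · refine ⟨c * p, ?_⟩
    obtain ⟨k, hk⟩ : ∃ k : ℕ, n = (k + 1 : ℤ) := ⟨(n - 1).toNat, by omega⟩
    rw [wm, wm, show (-(n - 1)).toNat = 0 by omega, show (-n).toNat = 0 by omega,
      show n.toNat = k + 1 by omega, show (n - 1).toNat = k by omega, map_mul, ← dxy]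
    ring

theorem wm_z (n : ℤ) (c : ℂ[X]) : wm p n c * dz p = wm p n (c * X) := by
  rw [wm, wm, map_mul, aeval_X]; ring

theorem Wm_surj : Function.Surjective (Wm p) := by
  intro a
  obtain ⟨a, rfl⟩ := Ideal.Quotient.mk_surjective a
  induction a using MvPolynomial.induction_on with
  | C c =>
    refine ⟨lC (C c) * lT 0, ?_⟩
    rw [Wm_mon, wm]
    simp
    rfl
  | add a b ha hb =>
    obtain ⟨F, hF⟩ := ha
    obtain ⟨G, hG⟩ := hb
    exact ⟨F + G, by rw [map_add, hF, hG, map_add]⟩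
  | mul_X a i ha =>
    obtain ⟨F, hF⟩ := ha
    rw [map_mul, ← hF]
    clear hF
    induction F using LaurentPolynomial.induction_on' with
    | add F G hF hG =>
      obtain ⟨F', hF⟩ := hF
      obtain ⟨G', hG⟩ := hG
      exact ⟨F' + G', by rw [map_add, hF, hG, map_add, add_mul]⟩
    | C_mul_T n c =>
      rw [Wm_mon]
      fin_cases i
      · obtain ⟨c', h⟩ := wm_x p n c
        exact ⟨lC c' * lT (n + 1), by rw [Wm_mon, ← h]; rfl⟩
      · obtain ⟨c', h⟩ := wm_y p n c
        exact ⟨lC c' * lT (n - 1), by rw [Wm_mon, ← h]; rfl⟩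
      · exact ⟨lC (c * X) * lT n, by rw [Wm_mon, ← wm_z]; rfl⟩

theorem iota_Wm (F : LZ) (m : ℤ) : (iota p (Wm p F)).coeff m = F.coeff m * p ^ (-m).toNat := by
  induction F using LaurentPolynomial.induction_on' with
  | add F G hF hG => rw [map_add, map_add, la_coeff, hF, hG, la_coeff, add_mul]
  | C_mul_T n c =>
    rw [Wm_mon, iota_wm, lmon_coeff, lmon_coeff]
    split_ifs with h
    · rw [h]
    · simp

variable {p}

theorem iota_inj (hp : p ≠ 0) : Function.Injective (iota p) := by
  rw [injective_iff_map_eq_zero]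
  intro a ha
  obtain ⟨F, rfl⟩ := Wm_surj p a
  have : F = 0 := by
    apply LaurentPolynomial.ext; intro m
    have := iota_Wm p F m
    rw [ha, AddMonoidAlgebra.coeff_zero, Finsupp.zero_apply] at this
    rw [AddMonoidAlgebra.coeff_zero, Finsupp.zero_apply]
    exact (mul_eq_zero.1 this.symm).resolve_right (pow_ne_zero _ hp)
  rw [this, map_zero]

theorem iota_range {f : LZ} : (∃ a, iota p a = f) ↔ f ∈ Rg p := by
  constructor
  · rintro ⟨a, rfl⟩
    obtain ⟨F, rfl⟩ := Wm_surj p a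
    intro m
    rw [iota_Wm]
    exact dvd_mul_left _ _
  · intro h
    have : f ∈ (iota p).range := by
      rw [lt_sum f]
      refine sum_mem fun n _ => ?_
      obtain ⟨c, hc⟩ := h n
      exact ⟨wm p n c, by
        change iota p _ = _
        rw [iota_wm, hc, mul_comm c]⟩
    exact this

theorem iota_mem (a : ODan p) : iota p a ∈ Rg p := iota_range.1 ⟨a, rfl⟩

theorem odan_domain (hp : p ≠ 0) : IsDomain (ODan p) :=
  (iota_inj hp).isDomain (iota p).toRingHom

/-- the swap automorphism -/
theorem swap_ex : ∃ ψ : ODan p →ₐ[ℂ] ODan p, ψ (dx p) = dy p ∧ ψ (dy p) = dx p ∧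
    ψ (dz p) = dz p := by
  apply dlift
  rw [mul_comm, dxy]

theorem hom_ext {B : Type} [CommRing B] [Algebra ℂ B] (f g : ODan p →ₐ[ℂ] B)
    (hx : f (dx p) = g (dx p)) (hy : f (dy p) = g (dy p)) (hz : f (dz p) = g (dz p)) : f = g := by
  refine AlgHom.ext_of_adjoin_eq_top (dgen p) ?_
  rintro a (rfl | rfl | rfl)
  exacts [hx, hy, hz]

theorem iota_large (w : LZ) : ∃ n : ℕ, w * lT n ∈ Rg p := by
  obtain ⟨n, f, hf⟩ := LaurentPolynomial.exists_T_pow w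
  refine ⟨n, ?_⟩
  intro i
  change _ ∣ (w * LaurentPolynomial.T n).coeff i
  rw [← hf]
  rcases le_or_gt 0 i with h | h
  · rw [show (-i).toNat = 0 by omega, pow_zero]; exact one_dvd _
  · rw [LaurentPolynomial.coeff_toLaurent]
    rw [Finsupp.mapDomain_of_notMem_range]
    · exact dvd_zero _
    · rintro ⟨k, hk⟩
      simp at hk
      omega

end ring

section pois
variable {p : ℂ[X]}

theorem lbr_self (a : LZ) : lbr a a = 0 := by rw [lbr]; ring
theorem lbr_skew (a b : LZ) : lbr a b = - lbr b a := by rw [lbr, lbr]; ring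
theorem lbr_add (a b c : LZ) : lbr a (b + c) = lbr a b + lbr a c := by
  rw [lbr, lbr, lbr, map_add, map_add]; ring
theorem lbr_smul (a b : LZ) (c : ℂ) : lbr a (c • b) = c • lbr a b := by
  rw [lbr, lbr, Derivation.map_smul, Derivation.map_smul, mul_smul_comm, mul_smul_comm, smul_sub]
theorem lbr_mul (a b c : LZ) : lbr a (b * c) = b * lbr a c + c * lbr a b := by
  simp only [lbr, Derivation.leibniz, smul_eq_mul]; ring
theorem lbr_alg (a : LZ) (c : ℂ) : lbr a (algebraMap ℂ LZ c) = 0 := by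
  rw [lbr, Derivation.map_algebraMap, Derivation.map_algebraMap]; ring

theorem lbr_gen (a : ODan p) (hx : lbr (iota p a) (lT 1) ∈ Rg p)
    (hy : lbr (iota p a) (lC p * lT (-1)) ∈ Rg p) (hz : lbr (iota p a) (lC X) ∈ Rg p)
    (b : ODan p) : lbr (iota p a) (iota p b) ∈ Rg p := by
  have hb : b ∈ Algebra.adjoin ℂ {dx p, dy p, dz p} := by rw [dgen]; trivial
  induction hb using Algebra.adjoin_induction with
  | mem b hb =>
    rcases hb with rfl | rfl | rfl
    · rw [iota_x]; exact hx
    · rw [iota_y]; exact hy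
    · rw [iota_z]; exact hz
  | algebraMap c => rw [AlgHom.commutes, lbr_alg]; exact zero_mem _
  | add b c _ _ hb hc => rw [map_add, lbr_add]; exact add_mem hb hc
  | mul b c _ _ hb hc =>
    rw [map_mul, lbr_mul]
    exact add_mem (mul_mem (iota_mem _) hc) (mul_mem (iota_mem _) hb)

theorem lbr_xz : lbr (lT 1) (lC X) = - lT 1 := by rw [lbr_skew, lbr_zx]
theorem lbr_zy (p : ℂ[X]) : lbr (lC X) (lC p * lT (-1)) = - (lC p * lT (-1)) := by
  rw [lbr, lE_mon, lE_C, lD_C]; simp; ring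
theorem lbr_xy (p : ℂ[X]) : lbr (lT 1) (lC p * lT (-1)) = - lC (derivative p) := by
  rw [lbr, lE_T, lD_T, lD_mon]
  have : lT 1 * lT (-1) = 1 := by rw [← lT_add]; simp
  push_cast
  linear_combination (- lC (derivative p)) * this

theorem x_Rg : lT 1 ∈ Rg p := by rw [← iota_x p]; exact iota_mem _
theorem y_Rg : lC p * lT (-1) ∈ Rg p := by rw [← iota_y p]; exact iota_mem _
theorem z_Rg (f : ℂ[X]) : lC f ∈ Rg p := by rw [← iota_az p f]; exact iota_mem _

theorem lbr_Rg (a b : ODan p) : lbr (iota p a) (iota p b) ∈ Rg p := by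
  have h1 : ∀ b, lbr (iota p (dx p)) (iota p b) ∈ Rg p := by
    apply lbr_gen <;> rw [iota_x]
    · rw [lbr_self]; exact zero_mem _
    · rw [lbr_xy]; exact neg_mem (z_Rg _)
    · rw [lbr_xz]; exact neg_mem x_Rg
  have h2 : ∀ b, lbr (iota p (dy p)) (iota p b) ∈ Rg p := by
    apply lbr_gen <;> rw [iota_y]
    · rw [lbr_skew, lbr_xy]; exact neg_mem (neg_mem (z_Rg _))
    · rw [lbr_self]; exact zero_mem _
    · rw [lbr_skew, lbr_zy]; exact neg_mem (neg_mem y_Rg)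
  have h3 : ∀ b, lbr (iota p (dz p)) (iota p b) ∈ Rg p := by
    apply lbr_gen <;> rw [iota_z]
    · rw [lbr_zx]; exact x_Rg
    · rw [lbr_zy]; exact neg_mem y_Rg
    · rw [lbr_self]; exact zero_mem _
  apply lbr_gen
  · rw [lbr_skew, ← iota_x p]; exact neg_mem (h1 a)
  · rw [lbr_skew, ← iota_y p]; exact neg_mem (h2 a)
  · rw [lbr_skew, ← iota_z p]; exact neg_mem (h3 a)

def pb (a b : ODan p) : ODan p := (iota_range.2 (lbr_Rg a b)).choose
theorem iota_pb (a b : ODan p) : iota p (pb a b) = lbr (iota p a) (iota p b) :=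
  (iota_range.2 (lbr_Rg a b)).choose_spec

def pbD (hp : p ≠ 0) (a : ODan p) : Derivation ℂ (ODan p) (ODan p) :=
  Derivation.mk' (M := ODan p)
    { toFun := pb a
      map_add' := fun b c => iota_inj hp (by
        rw [map_add, iota_pb, iota_pb, iota_pb, map_add, lbr_add])
      map_smul' := fun r b => iota_inj hp (by
        rw [RingHom.id_apply, iota_pb, map_smul, map_smul, iota_pb, lbr_smul]) }
    (fun b c => iota_inj hp (by
      change iota p (pb a (b * c)) = iota p (b * pb a c + c * pb a b)
      rw [map_add, map_mul, map_mul, iota_pb, iota_pb, iota_pb, map_mul, lbr_mul]))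

theorem iota_pbD (hp : p ≠ 0) (a b : ODan p) :
    iota p (pbD hp a b) = lbr (iota p a) (iota p b) := iota_pb a b

def pth (hp : p ≠ 0) : ODan p →ₗ[ℂ] Derivation ℂ (ODan p) (ODan p) where
  toFun := pbD hp
  map_add' a b := by
    ext c
    apply iota_inj hp
    rw [Derivation.add_apply, map_add, iota_pbD, iota_pbD, iota_pbD, map_add, lbr_skew, lbr_add,
      lbr_skew (iota p a), lbr_skew (iota p b)]
    ring
  map_smul' r a := by
    ext c
    apply iota_inj hp
    rw [RingHom.id_apply, Derivation.smul_apply, map_smul, iota_pbD, iota_pbD, map_smul, lbr_skew,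
      lbr_smul, lbr_skew (iota p a), smul_neg]

theorem iota_pth (hp : p ≠ 0) (a b : ODan p) :
    iota p (pth hp a b) = lbr (iota p a) (iota p b) := iota_pb a b

theorem lT_unit (n : ℤ) : lT n * lT (-n) = 1 := by rw [← lT_add]; simp

theorem lT_cancel {n : ℤ} {f : LZ} (h : lT n * f = 0) : f = 0 := by
  have : lT (-n) * (lT n * f) = f := by rw [← mul_assoc, mul_comm (lT (-n)), lT_unit, one_mul]
  rw [← this, h, mul_zero]

theorem const_of_lD {f : LZ} (h : lD f = 0) (n : ℤ) : f.coeff n = C ((f.coeff n).coeff 0) := by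
  have h1 := lD_coeff f n
  rw [h, AddMonoidAlgebra.coeff_zero, Finsupp.zero_apply] at h1
  exact eq_C_of_derivative_eq_zero h1.symm

theorem zero_of_lE {f : LZ} (h : lE f = 0) (n : ℤ) (hn : n ≠ 0) : f.coeff n = 0 := by
  have h1 := lE_coeff f n
  rw [h, AddMonoidAlgebra.coeff_zero, Finsupp.zero_apply] at h1
  exact (mul_eq_zero.1 h1.symm).resolve_left (by exact_mod_cast hn)

theorem alg_lC (c : ℂ) : algebraMap ℂ LZ c = lC (C c) := by
  simp [LaurentPolynomial.algebraMap_apply]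

theorem pth_ker (hp : p ≠ 0) (f : ODan p) (h : pth hp f = 0) :
    ∃ c, f = algebraMap ℂ (ODan p) c := by
  have hx := iota_pth hp f (dx p)
  have hz := iota_pth hp f (dz p)
  rw [h, Derivation.zero_apply, map_zero, iota_x, lbr, lE_T, lD_T] at hx
  rw [h, Derivation.zero_apply, map_zero, iota_z, lbr, lE_C, lD_C] at hz
  have hD : lD (iota p f) = 0 := by
    apply lT_cancel (n := 1)
    linear_combination (-1 : LZ) * hx + (-(lT 1 * lD (iota p f))) * (by simp : ((1 : ℤ) : LZ) = 1)
  have hE : lE (iota p f) = 0 := by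
    simp at hz
    exact hz
  refine ⟨((iota p f).coeff 0).coeff 0, iota_inj hp ?_⟩
  rw [AlgHom.commutes, alg_lC]
  apply LaurentPolynomial.ext; intro n
  rw [LaurentPolynomial.C_apply]
  split_ifs with hn
  · subst hn; exact const_of_lD hD 0
  · exact zero_of_lE hE n hn

theorem pth_kerx (hp2 : 2 ≤ p.natDegree) (hp : p ≠ 0) (g : ODan p) (h : pth hp (dx p) g = 0) :
    ∃ P : ℂ[X], g = aeval (dx p) P := by
  have hx := iota_pth hp (dx p) g
  rw [h, map_zero, iota_x, lbr, lE_T, lD_T] at hx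
  have hD : lD (iota p g) = 0 := by
    apply lT_cancel (n := 1)
    push_cast at hx
    linear_combination hx
  have hc := const_of_lD hD
  have hneg : ∀ n : ℤ, n < 0 → (iota p g).coeff n = 0 := by
    intro n hn
    have h1 := iota_mem g n
    by_contra h0
    have h2 := natDegree_le_of_dvd h1 h0
    rw [hc n, natDegree_C, natDegree_pow] at h2
    have : 1 ≤ (-n).toNat := by omega
    nlinarith
  refine ⟨∑ n ∈ (iota p g).coeff.support, C (((iota p g).coeff n).coeff 0) * X ^ n.toNat,
    iota_inj hp ?_⟩
  rw [map_sum, map_sum]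
  conv_lhs => rw [lt_sum (iota p g)]
  refine Finset.sum_congr rfl fun n hn => ?_
  have hn0 : 0 ≤ n := by
    by_contra hlt
    rw [Finsupp.mem_support_iff] at hn
    exact hn (hneg n (by omega))
  rw [map_mul, map_mul, aeval_C, AlgHom.commutes, alg_lC, ← hc n, map_pow, aeval_X, map_pow,
    iota_x, lT_pow]
  congr 2
  omega

theorem coeff0_div (f g : LZ) (hf : f ∈ Rg p) (hg : g ∈ Rg p) : p ∣ (f * lE g).coeff 0 := by
  rw [lt_sum f, lt_sum (lE g), Finset.sum_mul_sum, AddMonoidAlgebra.coeff_sum,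
    Finsupp.finset_sum_apply]
  refine Finset.dvd_sum fun n _ => ?_
  rw [AddMonoidAlgebra.coeff_sum, Finsupp.finset_sum_apply]
  refine Finset.dvd_sum fun m _ => ?_
  rw [lmon_mul, lmon_coeff, lE_coeff]
  split_ifs with h
  · rcases lt_trichotomy m 0 with h0 | h0 | h0
    · refine dvd_mul_of_dvd_right (dvd_mul_of_dvd_right (dvd_trans ?_ (hg m)) _) _
      exact dvd_pow_self _ (by omega)
    · subst h0; simp
    · refine dvd_mul_of_dvd_left (dvd_trans ?_ (hf n)) _
      exact dvd_pow_self _ (by omega)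
  · exact dvd_zero _

theorem pth_noone (hp2 : 2 ≤ p.natDegree) (hp : p ≠ 0) (c : ℂ)
    (h : algebraMap ℂ (ODan p) c ∈ Submodule.span ℂ {h | ∃ f g, h = pth hp f g}) : c = 0 := by
  have key : ∀ u ∈ Submodule.span ℂ {h | ∃ f g, h = pth hp f g},
      ∃ v, (iota p u).coeff 0 = derivative (p * v) := by
    intro u hu
    induction hu using Submodule.span_induction with
    | mem u hu =>
      obtain ⟨f, g, rfl⟩ := hu
      obtain ⟨v, hv⟩ := coeff0_div (iota p f) (iota p g) (iota_mem f) (iota_mem g)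
      refine ⟨v, ?_⟩
      have : lbr (iota p f) (iota p g) = lD (iota p f * lE (iota p g))
          - lE (iota p f * lD (iota p g)) := by
        simp only [lbr, Derivation.leibniz, smul_eq_mul, lED]; ring
      rw [iota_pth, this, ls_coeff, lD_coeff, hv, lE_coeff]
      simp
    | zero => exact ⟨0, by simp⟩
    | add a b _ _ ha hb =>
      obtain ⟨v, hv⟩ := ha
      obtain ⟨w, hw⟩ := hb
      exact ⟨v + w, by rw [map_add, la_coeff, hv, hw, mul_add, map_add]⟩
    | smul r a _ ha =>
      obtain ⟨v, hv⟩ := ha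
      refine ⟨r • v, ?_⟩
      rw [map_smul, AddMonoidAlgebra.coeff_smul, Finsupp.smul_apply, hv, mul_smul_comm,
        derivative_smul]
  obtain ⟨v, hv⟩ := key _ h
  rw [AlgHom.commutes, alg_lC, LaurentPolynomial.C_apply, if_pos rfl] at hv
  by_cases hv0 : v = 0
  · rw [hv0, mul_zero, map_zero] at hv
    exact C_eq_zero.1 hv
  · exfalso
    have h1 : (derivative (p * v)).natDegree = (p * v).natDegree - 1 := natDegree_derivative _
    rw [← hv, natDegree_C, natDegree_mul hp hv0] at h1
    omega

end pois

theorem int_ext {A S : Type} [CommRing A] [IsDomain A] [CommRing S] [IsDomain S]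
    [IsIntegrallyClosed S] (g : A →+* S) (hg : Function.Injective g) (a b : A) (hb : b ≠ 0)
    (hInteg : IsIntegral A (algebraMap A (FractionRing A) a / algebraMap A (FractionRing A) b)) :
    ∃ w, w * g b = g a := by
  let K := FractionRing A
  let F := FractionRing S
  let g' : A →+* F := (algebraMap S F).comp g
  have hg' : Function.Injective g' := (IsFractionRing.injective S F).comp hg
  let m : K →+* F := IsFractionRing.lift hg'
  have hm : ∀ d, m (algebraMap A K d) = algebraMap S F (g d) := fun d =>
    IsFractionRing.lift_algebraMap hg' d
  obtain ⟨P, hP, h0⟩ := hInteg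
  have h1 : IsIntegral S (m (algebraMap A K a / algebraMap A K b)) := by
    refine ⟨P.map g, hP.map g, ?_⟩
    rw [eval₂_map]
    have : (algebraMap S F).comp g = m.comp (algebraMap A K) := by
      ext d; exact (hm d).symm
    rw [this, ← hom_eval₂, h0, map_zero]
  obtain ⟨w, hw⟩ := IsIntegrallyClosed.isIntegral_iff.1 h1
  refine ⟨w, IsFractionRing.injective S F ?_⟩
  have hbF : algebraMap S F (g b) ≠ 0 := by
    intro h
    apply hb
    apply hg'
    rw [map_zero]; exact h
  rw [map_mul, hw, map_div₀, hm, hm, div_mul_cancel₀ _ hbF]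

instance lz_int : IsIntegrallyClosed LZ :=
  isIntegrallyClosed_of_isLocalization (R := ℂ[X][X]) LZ (Submonoid.powers X)
    (powers_le_nonZeroDivisors_of_noZeroDivisors X_ne_zero)

section pois2
variable {p : ℂ[X]}

theorem odan_int (hp : p ≠ 0) [IsDomain (ODan p)] : IsIntegrallyClosed (ODan p) := by
  rw [isIntegrallyClosed_iff (FractionRing (ODan p))]
  intro w hw
  obtain ⟨a, b, hb, rfl⟩ := IsFractionRing.div_surjective (A := ODan p) w
  have hb0 : b ≠ 0 := nonZeroDivisors.ne_zero hb
  have hι := iota_inj hp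
  obtain ⟨ω, hω⟩ := int_ext (iota p).toRingHom hι a b hb0 hw
  change ω * iota p b = iota p a at hω
  obtain ⟨s, sx, sy, sz⟩ := swap_ex (p := p)
  have hss : ∀ c, s (s c) = c := by
    have : s.comp s = AlgHom.id ℂ _ := by
      apply hom_ext <;> simp [sx, sy, sz]
    intro c
    exact DFunLike.congr_fun this c
  have hsinj : Function.Injective s := fun c d h => by rw [← hss c, h, hss]
  obtain ⟨ω', hω'⟩ := int_ext ((iota p).comp s).toRingHom (hι.comp hsinj) a b hb0 hw
  change ω' * iota p (s b) = iota p (s a) at hω'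
  obtain ⟨m, hm⟩ := iota_large (p := p) ω'
  obtain ⟨c', hc'⟩ := iota_range.2 hm
  have h1 : s (dy p ^ m * a) = s (s c' * b) := by
    apply hι
    rw [map_mul, map_mul, map_mul, map_mul, ← hω', map_pow, sy, hss, map_pow, iota_x, hc', lT_pow,
      mul_one]
    ring
  have h2 := congrArg (iota p) (hsinj h1)
  rw [map_mul, map_mul, ← hω, ← mul_assoc] at h2
  have hb1 : iota p b ≠ 0 := fun h => hb0 (hι (by rw [h, map_zero]))
  have h3 := mul_right_cancel₀ hb1 h2
  rw [map_pow, iota_y, mul_pow, lT_pow, ← map_pow] at h3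
  have h4 : lC (p ^ m) * ω = iota p (s c') * lT m := by
    rw [← h3]
    have := lT_unit (m : ℤ)
    rw [show ((m : ℤ) * (-1)) = -(m : ℤ) by ring]
    linear_combination (- lC (p ^ m) * ω) * this
  have hωR : ω ∈ Rg p := by
    intro j
    rcases le_or_gt 0 j with hj | hj
    · rw [show (-j).toNat = 0 by omega, pow_zero]; exact one_dvd _
    · have h5 := congrArg (fun f : LZ => f.coeff j) h4
      have h6 : (lC (p ^ m) * ω).coeff j = p ^ m * ω.coeff j := by
        rw [← LaurentPolynomial.smul_eq_C_mul, AddMonoidAlgebra.coeff_smul, Finsupp.smul_apply,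
          smul_eq_mul]
      have h7 : (iota p (s c') * lT m).coeff j = (iota p (s c')).coeff (j - m) := by
        generalize iota p (s c') = F
        induction F using LaurentPolynomial.induction_on' with
        | add F G hF hG => rw [add_mul, la_coeff, hF, hG, la_coeff]
        | C_mul_T n f =>
          rw [mul_assoc]
          change (lC f * (lT n * lT m)).coeff j = (lC f * lT n).coeff (j - m)
          rw [← lT_add, lmon_coeff, lmon_coeff]
          congr 1
          rw [eq_iff_iff]; omega
      rw [h6, h7] at h5
      have h8 := iota_mem (s c') (j - m)
      rw [← h5, show (-(j - m)).toNat = m + (-j).toNat by omega, pow_add] at h8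
      exact (mul_dvd_mul_iff_left (pow_ne_zero _ hp)).1 h8
  obtain ⟨d, hd⟩ := iota_range.2 hωR
  refine ⟨d, ?_⟩
  have h9 : a = d * b := hι (by rw [map_mul, hd, hω])
  have hbK : algebraMap (ODan p) (FractionRing (ODan p)) b ≠ 0 := by simpa using hb0
  rw [h9, map_mul, mul_div_cancel_right₀ _ hbK]

theorem antider (s : ℂ[X]) : ∃ r, derivative r = s := by
  induction s using Polynomial.induction_on' with
  | add a b ha hb =>
    obtain ⟨r, hr⟩ := ha
    obtain ⟨t, ht⟩ := hb
    exact ⟨r + t, by rw [map_add, hr, ht]⟩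
  | monomial n c =>
    refine ⟨monomial (n + 1) (c / (n + 1)), ?_⟩
    rw [derivative_monomial]
    have : ((n : ℂ) + 1) ≠ 0 := by exact_mod_cast Nat.succ_ne_zero n
    push_cast
    rw [div_mul_cancel₀ _ this]

theorem twist_zero {A : Type} [CommRing A] [Algebra ℂ A] (δ : Derivation ℂ A A) (g : A)
    (θ : A →ₗ[ℂ] Derivation ℂ A A)
    (h : ∀ a b, δ (θ a b) - g * θ a b = θ (δ a) b + θ a (δ b)) (N : ℕ) :
    ∀ n m a b, n + m = N → δ^[n] a = 0 → δ^[m] b = 0 →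
      (fun v => δ v - g * v)^[N] (θ a b) = 0 := by
  have hz : ∀ N : ℕ, (fun v => δ v - g * v)^[N] 0 = 0 := by
    intro N
    induction N with
    | zero => rfl
    | succ N ih => rw [Function.iterate_succ_apply]; simpa using ih
  have ha : ∀ (N : ℕ) u v, (fun v => δ v - g * v)^[N] (u + v) =
      (fun v => δ v - g * v)^[N] u + (fun v => δ v - g * v)^[N] v := by
    intro N
    induction N with
    | zero => intros; rfl
    | succ N ih =>
      intro u v
      rw [Function.iterate_succ_apply, Function.iterate_succ_apply, Function.iterate_succ_apply,
        ← ih]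
      congr 1
      rw [map_add]; ring
  induction N with
  | zero =>
    intro n m a b hnm hn hm
    obtain rfl : n = 0 := by omega
    have : a = 0 := hn
    rw [this]; simp
  | succ N ih =>
    intro n m a b hnm hn hm
    rcases n with _ | n
    · have : a = 0 := hn
      rw [this, map_zero, Derivation.zero_apply, hz]
    rcases m with _ | m
    · have : b = 0 := hm
      rw [this, map_zero, hz]
    rw [Function.iterate_succ_apply]
    rw [h, ha, ih n (m + 1) (δ a) b (by omega) hn hm, ih (n + 1) m a (δ b) (by omega) hn hm,
      add_zero]

theorem ham_form (hp : p ≠ 0) (δ : Derivation ℂ (ODan p) (ODan p)) (a : ODan p) :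
    iota p (δ a) = (iota p (δ (dx p)) * lT (-1)) * lE (iota p a)
      + iota p (δ (dz p)) * lD (iota p a) := by
  have hu := lT_unit 1
  have ha : a ∈ Algebra.adjoin ℂ {dx p, dy p, dz p} := by rw [dgen]; trivial
  induction ha using Algebra.adjoin_induction with
  | mem a ha =>
    rcases ha with rfl | rfl | rfl
    · rw [iota_x, lE_T, lD_T]
      push_cast
      linear_combination (-iota p (δ (dx p))) * hu
    · have h1 := congrArg (fun u => iota p (δ u)) (dxy p)
      rw [Derivation.leibniz, Derivation.map_aeval, smul_eq_mul, smul_eq_mul, smul_eq_mul, map_add,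
        map_mul, map_mul, map_mul, iota_az, iota_x, iota_y] at h1
      rw [iota_y, lE_mon, lD_mon]
      push_cast
      linear_combination lT (-1) * h1 - (iota p (δ (dy p))) * hu
    · rw [iota_z, lE_C, lD_C]
      simp
  | algebraMap c =>
    rw [AlgHom.commutes, Derivation.map_algebraMap, Derivation.map_algebraMap,
      Derivation.map_algebraMap, map_zero, mul_zero, mul_zero, add_zero]
  | add a b _ _ ha hb => rw [map_add, map_add, map_add, map_add, map_add, ha, hb]; ring
  | mul a b _ _ ha hb =>
    rw [Derivation.leibniz, map_mul, Derivation.leibniz, Derivation.leibniz, map_add, smul_eq_mul,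
      smul_eq_mul, map_mul, map_mul, ha, hb, smul_eq_mul, smul_eq_mul, smul_eq_mul, smul_eq_mul]
    ring

theorem div_form (α β F G : LZ) :
    α * lE (lbr F G) + β * lD (lbr F G) - lbr (α * lE F + β * lD F) G
      - lbr F (α * lE G + β * lD G) = -(lE α + lD β) * lbr F G := by
  simp only [lbr, map_sub, map_add, Derivation.leibniz, smul_eq_mul, lED]
  ring

theorem pth_ham (hsq : Squarefree p) (hp2 : 2 ≤ p.natDegree) (hp : p ≠ 0) [IsDomain (ODan p)]
    (δ : Derivation ℂ (ODan p) (ODan p)) (hδ : LN δ) : ∃ f, δ = pth hp f := by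
  have hι := iota_inj hp
  have hu := lT_unit 1
  obtain ⟨α, hα⟩ : ∃ α, α = iota p (δ (dx p)) * lT (-1) := ⟨_, rfl⟩
  obtain ⟨β, hβ⟩ : ∃ β, β = iota p (δ (dz p)) := ⟨_, rfl⟩
  have hform : ∀ a, iota p (δ a) = α * lE (iota p a) + β * lD (iota p a) := by
    rw [hα, hβ]; exact ham_form hp δ
  have hdiv : ∀ a b, iota p (δ (pth hp a b) - pth hp (δ a) b - pth hp a (δ b)) =
      -(lE α + lD β) * lbr (iota p a) (iota p b) := by
    intro a b
    rw [← div_form, map_sub, map_sub, iota_pth, iota_pth, hform, hform, hform, iota_pth]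
  have hcop : IsCoprime p (derivative p) := (PerfectField.separable_iff_squarefree.2 hsq)
  obtain ⟨u, v, huv⟩ := hcop
  have hγ : -(lE α + lD β) ∈ Rg p := by
    have h1 : -(lE α + lD β) * lC (derivative p) ∈ Rg p := by
      have := hdiv (dy p) (dx p)
      rw [lbr_skew, iota_x, iota_y, lbr_xy, neg_neg] at this
      rw [← this]; exact iota_mem _
    have h2 : -(lE α + lD β) * lC p ∈ Rg p := by
      have := hdiv (dy p) (dz p)
      rw [lbr_skew, iota_z, iota_y, lbr_zy, neg_neg] at this
      have h3 : -(lE α + lD β) * lC p = (-(lE α + lD β) * (lC p * lT (-1))) * lT 1 := by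
        linear_combination ((lE α + lD β) * lC p) * hu
      rw [h3, ← this]
      exact mul_mem (iota_mem _) x_Rg
    have h3 : -(lE α + lD β) = lC u * (-(lE α + lD β) * lC p)
        + lC v * (-(lE α + lD β) * lC (derivative p)) := by
      have := congrArg lC huv
      rw [map_add, map_mul, map_mul, map_one] at this
      linear_combination (lE α + lD β) * this
    rw [h3]
    exact add_mem (mul_mem (z_Rg _) h2) (mul_mem (z_Rg _) h1)
  obtain ⟨g, hg⟩ := iota_range.2 hγ
  have hder : ∀ a b, δ (pth hp a b) - g * pth hp a b = pth hp (δ a) b + pth hp a (δ b) := by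
    intro a b
    have := hdiv a b
    rw [← hg, ← iota_pth hp, ← map_mul] at this
    have := hι this
    linear_combination this
  have hzx : pth hp (dz p) (dx p) = dx p := by
    apply hι; rw [iota_pth, iota_z, iota_x, lbr_zx]
  have hx0 : dx p ≠ 0 := by
    intro h
    have h1 := iota_x p
    rw [h, map_zero] at h1
    have h2 := lT_unit 1
    rw [← h1, zero_mul] at h2
    exact zero_ne_one h2
  have hg0 : g = 0 := by
    obtain ⟨n, hn⟩ := hδ (dz p)
    obtain ⟨m, hm⟩ := hδ (dx p)
    have hex : ∃ N, (fun v => δ v - g * v)^[N] (dx p) = 0 := by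
      refine ⟨n + m, ?_⟩
      have := twist_zero δ g (pth hp) hder (n + m) n m (dz p) (dx p) rfl hn hm
      rwa [hzx] at this
    classical
    obtain ⟨N, hN, hmin⟩ : ∃ N, (fun v => δ v - g * v)^[N] (dx p) = 0 ∧
        ∀ k < N, (fun v => δ v - g * v)^[k] (dx p) ≠ 0 :=
      ⟨Nat.find hex, Nat.find_spec hex, fun k hk => Nat.find_min hex hk⟩
    rcases N with _ | N
    · exact absurd hN hx0
    · have hv0 := hmin N (by omega)
      rw [Function.iterate_succ_apply'] at hN
      generalize (fun v => δ v - g * v)^[N] (dx p) = w at hN hv0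
      have h1 : δ w = g * w := sub_eq_zero.1 hN
      have h2 := ln_eigen δ hδ w g h1
      rw [h2] at h1
      exact (mul_eq_zero.1 h1.symm).resolve_right hv0
  have hrel : lE α + lD β = 0 := by
    rw [hg0, map_zero] at hg
    exact neg_eq_zero.1 hg.symm
  have hreln : ∀ n : ℤ, (n : ℂ[X]) * α.coeff n + derivative (β.coeff n) = 0 := by
    intro n
    have := congrArg (fun f : LZ => f.coeff n) hrel
    rwa [la_coeff, lE_coeff, lD_coeff, AddMonoidAlgebra.coeff_zero, Finsupp.zero_apply] at this
  have hβR : β ∈ Rg p := by rw [hβ]; exact iota_mem _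
  have hβ0 : β.coeff 0 = 0 := by
    have h1 := hreln 0
    simp only [Int.cast_zero, zero_mul, zero_add] at h1
    have h2 := eq_C_of_derivative_eq_zero h1
    have h3 := iota_mem (δ (dy p)) (-1)
    have hc : ∀ (F : LZ) (c : ℂ[X]), (F * (lC c * lT (-1))).coeff (-1) = F.coeff 0 * c := by
      intro F c
      induction F using LaurentPolynomial.induction_on' with
      | add F G hF hG => rw [add_mul, la_coeff, hF, hG, la_coeff, add_mul]
      | C_mul_T n f =>
        change ((lC f * lT n) * (lC c * lT (-1))).coeff (-1) = (lC f * lT n).coeff 0 * c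
        rw [lmon_mul, lmon_coeff, lmon_coeff]
        by_cases hn : n = 0
        · rw [if_pos (by omega), if_pos hn]
        · rw [if_neg (by omega), if_neg hn, zero_mul]
    have h4 : iota p (δ (dy p)) = α * (lC (-p) * lT (-1)) + β * (lC (derivative p) * lT (-1)) := by
      rw [hform, iota_y, lE_mon, lD_mon, map_neg]
      push_cast; ring
    rw [h4, la_coeff, hc, hc, show (-(-1 : ℤ)).toNat = 1 by omega, pow_one] at h3
    have h5 : p ∣ β.coeff 0 * derivative p := by
      have := dvd_sub h3 (Dvd.intro_left (α.coeff 0) rfl : p ∣ α.coeff 0 * p)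
      have := dvd_add h3 (Dvd.intro_left (α.coeff 0) rfl : p ∣ α.coeff 0 * p)
      ring_nf at this ⊢
      exact this
    have h6 : p ∣ β.coeff 0 := (show IsCoprime p (derivative p) from ⟨u, v, huv⟩).dvd_of_dvd_mul_right h5
    by_contra h0
    have h7 := natDegree_le_of_dvd h6 h0
    rw [h2, natDegree_C] at h7
    omega
  obtain ⟨r, hr⟩ := antider (α.coeff 0)
  obtain ⟨f, hf⟩ : ∃ f : LZ, ∀ n, f.coeff n = C (-((n : ℂ)⁻¹)) * β.coeff n
      + if n = 0 then r else 0 := by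
    refine ⟨mkLT β (fun n => C (-((n : ℂ)⁻¹)) * β.coeff n) (fun n h => by rw [h, mul_zero])
      + lC r, fun n => ?_⟩
    rw [la_coeff, mkLT_coeff, LaurentPolynomial.C_apply]
  have hnn : ∀ n : ℤ, n ≠ 0 → (n : ℂ[X]) * C ((n : ℂ)⁻¹) = 1 := by
    intro n hn
    have : (n : ℂ[X]) = C (n : ℂ) := by simp
    rw [this, ← C_mul, mul_inv_cancel₀ (by exact_mod_cast hn), C_1]
  have hfE : lE f = -β := by
    apply LaurentPolynomial.ext; intro n
    rw [lE_coeff, hf, AddMonoidAlgebra.coeff_neg, Finsupp.neg_apply]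
    by_cases hn : n = 0
    · subst hn; rw [hβ0]; simp
    · rw [if_neg hn, C_neg]
      linear_combination (-β.coeff n) * hnn n hn
  have hfD : lD f = α := by
    apply LaurentPolynomial.ext; intro n
    rw [lD_coeff, hf]
    by_cases hn : n = 0
    · subst hn; rw [hβ0]; simp [hr]
    · rw [if_neg hn, C_neg, add_zero, ← C_neg, derivative_C_mul, C_neg]
      linear_combination (-C ((n : ℂ)⁻¹)) * hreln n + α.coeff n * hnn n hn
  have hfR : f ∈ Rg p := by
    intro n
    rw [hf]
    rcases le_or_gt 0 n with h | h
    · rw [show (-n).toNat = 0 by omega, pow_zero]; exact one_dvd _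
    · rw [if_neg (by omega), add_zero]
      exact dvd_mul_of_dvd_right (hβR n) _
  obtain ⟨h, hh⟩ := iota_range.2 hfR
  refine ⟨h, ?_⟩
  ext a
  apply hι
  rw [iota_pth, hform, hh, lbr, hfE, hfD]
  ring

def danData (p : ℂ[X]) (hsq : Squarefree p) (hp2 : 2 ≤ p.natDegree) (hp : p ≠ 0)
    [IsDomain (ODan p)] : DanData p (ODan p) where
  θ := pth hp
  skew f g := iota_inj hp (by rw [map_neg, iota_pth, iota_pth, lbr_skew])
  jac f g := by
    ext h
    apply iota_inj hp
    rw [Derivation.commutator_apply, map_sub, iota_pth, iota_pth, iota_pth, iota_pth, iota_pth,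
      iota_pth, lbr_jac]
  pluck a b c e := iota_inj hp (by
    simp only [map_add, map_sub, map_mul, iota_pth, map_zero, lbr]
    ring)
  ker := pth_ker hp
  noone := pth_noone hp2 hp
  x := dx p
  y := dy p
  z := dz p
  x0 := by
    intro h
    have h1 := iota_x p
    rw [h, map_zero] at h1
    have h2 := lT_unit 1
    rw [← h1, zero_mul] at h2
    exact zero_ne_one h2
  xy := dxy p
  gen := dgen p
  zx := iota_inj hp (by rw [iota_pth, iota_z, iota_x, lbr_zx])
  kerx := pth_kerx hp2 hp
  ham := pth_ham hsq hp2 hp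
  univ := dlift p
  deg := hp2

theorem danData_L (p : ℂ[X]) (hsq : Squarefree p) (hp2 : 2 ≤ p.natDegree) (hp : p ≠ 0)
    [IsDomain (ODan p)] : (danData p hsq hp2 hp).L = lndSpan p := by
  have : {δ : Derivation ℂ (ODan p) (ODan p) | LN δ} = {δ | IsLND δ} := by
    ext δ
    constructor
    · intro h f
      obtain ⟨n, hn⟩ := h f
      refine ⟨n + 1, by omega, ?_⟩
      rw [Module.End.pow_apply]
      exact iter_mono δ (Nat.le_succ n) hn
    · intro h f
      obtain ⟨n, _, hn⟩ := h f
      refine ⟨n, ?_⟩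
      rw [Module.End.pow_apply] at hn
      exact hn
  rw [DanData.L, this, lndSpan]

end pois2

/-- If `p, q` are squarefree of degree at least `2` and the Lie algebras `⟨LND(D_p)⟩`
and `⟨LND(D_q)⟩` are isomorphic, then the Danielewski surfaces `D_p` and `D_q` are
isomorphic as varieties, i.e. `O(D_p) ≅ O(D_q)` as `ℂ`-algebras. -/
theorem lndSpan_equiv_implies_iso (p q : ℂ[X])
    (hsp : Squarefree p) (hsq : Squarefree q)
    (hp2 : 2 ≤ p.natDegree) (hq2 : 2 ≤ q.natDegree)
    (h : Nonempty (lndSpan p ≃ₗ⁅ℂ⁆ lndSpan q)) :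
    Nonempty (ODan p ≃ₐ[ℂ] ODan q) := by
  obtain ⟨φ⟩ := h
  have hp : p ≠ 0 := hsp.ne_zero
  have hq : q ≠ 0 := hsq.ne_zero
  haveI : IsDomain (ODan p) := odan_domain hp
  haveI : IsDomain (ODan q) := odan_domain hq
  haveI : IsIntegrallyClosed (ODan p) := odan_int hp
  haveI : IsIntegrallyClosed (ODan q) := odan_int hq
  rw [← danData_L p hsp hp2 hp, ← danData_L q hsq hq2 hq] at φ
  exact stage3 _ _ φ

end
end

section
/- Let p ∈ ℂ[z] be a polynomial of degree at least 2 without multiple roots. For every f ∈ O(D_p), neither ν_x(f) nor ν_y(f) is a nonzero constant; that is, if ν_x(f) ∈ ℂ·1 then ν_x(f) = 0, and likewise for ν_y. -/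
open Polynomial

set_option synthInstance.maxHeartbeats 400000
set_option maxHeartbeats 800000

noncomputable section

/-- The lift `p'(z)∂/∂y + x∂/∂z` of `ν_x` to a derivation of `ℂ[x,y,z]`. -/
def nuxLift (p : ℂ[X]) : Derivation ℂ P3 P3 :=
  MvPolynomial.mkDerivation ℂ ![0, Polynomial.aeval zP (Polynomial.derivative p), xP]

/-- The lift `p'(z)∂/∂x + y∂/∂z` of `ν_y` to a derivation of `ℂ[x,y,z]`. -/
def nuyLift (p : ℂ[X]) : Derivation ℂ P3 P3 :=
  MvPolynomial.mkDerivation ℂ ![Polynomial.aeval zP (Polynomial.derivative p), 0, yP]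

theorem core_aux (p : ℂ[X]) (a b c : ℂ) (hab : a ≠ b) (D : Derivation ℂ P3 P3) (F : P3)
    (hF : D F - MvPolynomial.C c ∈ relIdeal p)
    (v w : ℂ → Fin 3 → ℂ[X])
    (H1 : ∀ t, t ≠ 0 → MvPolynomial.aeval (v t) (xP * yP - Polynomial.aeval zP p) = 0)
    (H2 : ∀ t, t ≠ 0 → ∀ k, Polynomial.C t * derivative (v t k) =
      MvPolynomial.aeval (v t) (D (MvPolynomial.X k)))
    (Ha : ∀ t, t ≠ 0 → ∀ k, (v t k).eval a = (w a k).eval t)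
    (Hb : ∀ t, t ≠ 0 → ∀ k, (v t k).eval b = (w b k).eval t) : c = 0 := by
  have hD : ∀ t, t ≠ 0 → ∀ G : P3, Polynomial.C t * derivative (MvPolynomial.aeval (v t) G) =
      MvPolynomial.aeval (v t) (D G) := by
    intro t ht G
    induction G using MvPolynomial.induction_on with
    | C r =>
      have : D (MvPolynomial.C r) = 0 := D.map_algebraMap r
      rw [this, MvPolynomial.aeval_C, Polynomial.algebraMap_eq]
      simp
    | add f g hf hg => simp only [map_add, mul_add, hf, hg]
    | mul_X f k hf =>
      simp only [map_mul, Derivation.leibniz, map_add, smul_eq_mul, derivative_mul,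
        MvPolynomial.aeval_X, ← hf, ← H2 t ht k]
      ring
  have hev : ∀ s : ℂ, (∀ t, t ≠ 0 → ∀ k, (v t k).eval s = (w s k).eval t) →
      ∀ t, t ≠ 0 → ∀ G : P3, (MvPolynomial.aeval (v t) G).eval s =
        (MvPolynomial.aeval (w s) G).eval t := by
    intro s hs t ht G
    induction G using MvPolynomial.induction_on with
    | C r => simp [MvPolynomial.aeval_C, Polynomial.algebraMap_eq]
    | add f g hf hg => simp only [map_add, eval_add, hf, hg]
    | mul_X f k hf => simp only [map_mul, eval_mul, hf, MvPolynomial.aeval_X, hs t ht k]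
  have key : ∀ t, t ≠ 0 → t * ((MvPolynomial.aeval (w b) F).eval t -
      (MvPolynomial.aeval (w a) F).eval t) = c * (b - a) := by
    intro t ht
    have h0 : MvPolynomial.aeval (v t) (D F - MvPolynomial.C c) = 0 := by
      obtain ⟨g, hg⟩ := Ideal.mem_span_singleton'.1 hF
      rw [← hg, map_mul, H1 t ht, mul_zero]
    rw [map_sub, ← hD t ht, MvPolynomial.aeval_C, Polynomial.algebraMap_eq] at h0
    set Q := MvPolynomial.aeval (v t) F with hQ
    have h1 : derivative (Polynomial.C t * Q - Polynomial.C c * X) = 0 := by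
      simpa using h0
    have h2 := Polynomial.eq_C_of_derivative_eq_zero h1
    have ea := congrArg (Polynomial.eval a) h2
    have eb := congrArg (Polynomial.eval b) h2
    simp only [eval_sub, eval_mul, eval_C, eval_X] at ea eb
    rw [← hev a Ha t ht F, ← hev b Hb t ht F, ← hQ]
    linear_combination eb - ea
  set R : ℂ[X] := X * (X * (MvPolynomial.aeval (w b) F - MvPolynomial.aeval (w a) F)
    - Polynomial.C (c * (b - a))) with hR
  have hR0 : R = 0 := by
    apply Polynomial.funext
    intro t
    by_cases ht : t = 0
    · simp [hR, ht]
    · have := key t ht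
      simp only [hR, eval_mul, eval_X, eval_sub, eval_C, eval_zero, this, sub_self, mul_zero]
  have h3 := (mul_eq_zero.1 hR0).resolve_left X_ne_zero
  have h4 := congrArg (Polynomial.eval 0) h3
  simp only [eval_mul, eval_X, eval_sub, eval_C, eval_zero, zero_mul, zero_sub,
    neg_eq_zero, mul_eq_zero, sub_eq_zero] at h4
  exact h4.resolve_right (Ne.symm hab)

theorem two_roots (p : ℂ[X]) (hsp : Squarefree p) (hp2 : 2 ≤ p.natDegree) :
    ∃ a b : ℂ, a ≠ b ∧ p.eval a = 0 ∧ p.eval b = 0 := by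
  have hs : p.Separable := PerfectField.separable_iff_squarefree.2 hsp
  have hc : p.roots.toFinset.card = p.natDegree := by
    rw [Multiset.toFinset_card_of_nodup (nodup_roots hs)]
    exact (IsAlgClosed.splits p).natDegree_eq_card_roots.symm
  obtain ⟨a, ha, b, hb, hab⟩ := Finset.one_lt_card.1 (show 1 < p.roots.toFinset.card by omega)
  exact ⟨a, b, hab, (mem_roots'.1 (Multiset.mem_toFinset.1 ha)).2,
    (mem_roots'.1 (Multiset.mem_toFinset.1 hb)).2⟩

theorem aeval_zP (p : ℂ[X]) (v : Fin 3 → ℂ[X]) (hv : v 2 = X) :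
    MvPolynomial.aeval v (Polynomial.aeval zP p) = p := by
  rw [← Polynomial.aeval_algHom_apply, zP, MvPolynomial.aeval_X, hv, Polynomial.aeval_X_left_apply]

/-- Let `p` be squarefree of degree at least `2`, and let `ν_x`, `ν_y` be the derivations
of `O(D_p)` induced by `p'(z)∂/∂y + x∂/∂z` and `p'(z)∂/∂x + y∂/∂z`.  For every
`f ∈ O(D_p)`, neither `ν_x(f)` nor `ν_y(f)` is a nonzero constant. -/
theorem nux_nuy_no_nonzero_constant (p : ℂ[X])
    (hsp : Squarefree p) (hp2 : 2 ≤ p.natDegree)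
    (νx νy : Derivation ℂ (ODan p) (ODan p))
    (hνx : ∀ f : P3, νx (Ideal.Quotient.mk (relIdeal p) f) =
      Ideal.Quotient.mk (relIdeal p) (nuxLift p f))
    (hνy : ∀ f : P3, νy (Ideal.Quotient.mk (relIdeal p) f) =
      Ideal.Quotient.mk (relIdeal p) (nuyLift p f)) :
    ∀ f : ODan p,
      (νx f ∈ Set.range (algebraMap ℂ (ODan p)) → νx f = 0) ∧
      (νy f ∈ Set.range (algebraMap ℂ (ODan p)) → νy f = 0) := by
  obtain ⟨a, b, hab, ha, hb⟩ := two_roots p hsp hp2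
  intro f
  obtain ⟨F, rfl⟩ := Ideal.Quotient.mk_surjective f
  have fin : ∀ c : ℂ, c = 0 → algebraMap ℂ (ODan p) c = 0 := by
    rintro c rfl
    exact map_zero _
  constructor
  · rintro ⟨c, hc⟩
    rw [← hc]
    apply fin
    rw [hνx] at hc
    refine core_aux p a b c hab (nuxLift p) F (Ideal.Quotient.eq.1 hc.symm)
      (fun t => ![Polynomial.C t, Polynomial.C t⁻¹ * p, X])
      (fun s => ![X, 0, Polynomial.C s]) ?_ ?_ ?_ ?_
    · intro t ht
      rw [map_sub, aeval_zP _ _ (by simp), map_mul, xP, yP, MvPolynomial.aeval_X,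
        MvPolynomial.aeval_X]
      simp [← mul_assoc, ← Polynomial.C_mul, ht]
    · intro t ht k
      rw [nuxLift, MvPolynomial.mkDerivation_X]
      fin_cases k
      · simp
      · simp only [Fin.mk_one, Matrix.cons_val_one, Matrix.cons_val_zero]
        rw [aeval_zP _ _ (by simp)]
        simp [← mul_assoc, ← Polynomial.C_mul, ht]
      · simp [xP]
    · intro t ht k
      fin_cases k <;> simp [ha]
    · intro t ht k
      fin_cases k <;> simp [hb]
  · rintro ⟨c, hc⟩
    rw [← hc]
    apply fin
    rw [hνy] at hc
    refine core_aux p a b c hab (nuyLift p) F (Ideal.Quotient.eq.1 hc.symm)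
      (fun t => ![Polynomial.C t⁻¹ * p, Polynomial.C t, X])
      (fun s => ![0, X, Polynomial.C s]) ?_ ?_ ?_ ?_
    · intro t ht
      rw [map_sub, aeval_zP _ _ (by simp), map_mul, xP, yP, MvPolynomial.aeval_X,
        MvPolynomial.aeval_X, mul_comm]
      simp [← mul_assoc, ← Polynomial.C_mul, ht]
    · intro t ht k
      rw [nuyLift, MvPolynomial.mkDerivation_X]
      fin_cases k
      · simp only [Fin.zero_eta, Matrix.cons_val_zero]
        rw [aeval_zP _ _ (by simp)]
        simp [← mul_assoc, ← Polynomial.C_mul, ht]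
      · simp
      · simp [yP]
    · intro t ht k
      fin_cases k <;> simp [ha]
    · intro t ht k
      fin_cases k <;> simp [hb]

end
end
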